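/- Let (R, m) be a commutative Noetherian local ring, let 𝔞 be a proper ideal of R, and let M be a finitely generated R-module that is relative Cohen-Macaulay with respect to 𝔞 with ht_M 𝔞 = n. Suppose that both the Gorenstein injective dimension Gid_R(H^n_𝔞(M)) and the Gorenstein flat dimension Gfd_R(H^n_𝔞(M)) are finite. Then pd_R M is finite if and only if id_R M is finite. -/

import Mathlib

/-!
Definitions needed to state results of "On flat and Gorenstein flat dimensions of
local cohomology modules" by M.R. Zargar and H. Zakeri.
-/

open CategoryTheory IsLocalRing

universe u

namespace Paper

variable (R : Type u) [CommRing R]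

/-! ## Resolution/coresolution dimensions with respect to a class of modules -/

/-- `ResDimLE R P n M` : `M` admits a resolution `0 → Xₙ → ⋯ → X₀ → M → 0`
with each `Xᵢ` in the class `P`. -/
def ResDimLE (P : ModuleCat.{u} R → Prop) : ℕ → ModuleCat.{u} R → Prop
  | 0, M => P M
  | n + 1, M => ResDimLE P n M ∨
      ∃ (X : ModuleCat.{u} R) (f : X →ₗ[R] M), P X ∧ Function.Surjective f ∧
        ResDimLE P n (ModuleCat.of R (LinearMap.ker f))

/-- `CoresDimLE R P n M` : `M` admits a coresolution `0 → M → X₀ → ⋯ → Xₙ → 0`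
with each `Xᵢ` in the class `P`. -/
def CoresDimLE (P : ModuleCat.{u} R → Prop) : ℕ → ModuleCat.{u} R → Prop
  | 0, M => P M
  | n + 1, M => CoresDimLE P n M ∨
      ∃ (X : ModuleCat.{u} R) (f : M →ₗ[R] X), P X ∧ Function.Injective f ∧
        CoresDimLE P n (ModuleCat.of R (X ⧸ LinearMap.range f))

/-- The resolution dimension of `M` with respect to the class `P`, as an
extended natural number (`⊤` if there is no finite resolution). -/
noncomputable def ResDim (P : ModuleCat.{u} R → Prop) (M : ModuleCat.{u} R) : ℕ∞ :=
  sInf {n : ℕ∞ | ∃ k : ℕ, (k : ℕ∞) = n ∧ ResDimLE R P k M}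

/-- The coresolution dimension of `M` with respect to the class `P`. -/
noncomputable def CoresDim (P : ModuleCat.{u} R → Prop) (M : ModuleCat.{u} R) : ℕ∞ :=
  sInf {n : ℕ∞ | ∃ k : ℕ, (k : ℕ∞) = n ∧ CoresDimLE R P k M}

/-- Flat dimension `fd_R M`. -/
noncomputable def flatDim (M : Type u) [AddCommGroup M] [Module R M] : ℕ∞ :=
  ResDim R (fun N => Module.Flat R N) (ModuleCat.of R M)

/-- Projective dimension `pd_R M`. -/
noncomputable def projDim (M : Type u) [AddCommGroup M] [Module R M] : ℕ∞ :=
  ResDim R (fun N => Module.Projective R N) (ModuleCat.of R M)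

/-- Injective dimension `id_R M`. -/
noncomputable def injDim (M : Type u) [AddCommGroup M] [Module R M] : ℕ∞ :=
  CoresDim R (fun N => Module.Injective R N) (ModuleCat.of R M)

/-! ## Local cohomology -/

/-- The local cohomology module `H^i_𝔞(M)`, as an object of `ModuleCat R`. -/
noncomputable def lcoh (𝔞 : Ideal R) (i : ℕ) (M : Type u) [AddCommGroup M] [Module R M] :
    ModuleCat.{u} R :=
  (localCohomology 𝔞 i).obj (ModuleCat.of R M)

/-- `M` is relative Cohen-Macaulay with respect to `𝔞` with `ht_M 𝔞 = n`, i.e. the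
`n`-th local cohomology of `M` with respect to `𝔞` is the only non-vanishing one. -/
def IsRelCM (𝔞 : Ideal R) (n : ℕ) (M : Type u) [AddCommGroup M] [Module R M] : Prop :=
  (∀ i : ℕ, i ≠ n → Subsingleton (lcoh R 𝔞 i M)) ∧ ¬ Subsingleton (lcoh R 𝔞 n M)

/-! ## Depth, dimension, Cohen-Macaulay -/

/-- The depth of a module over a local ring: the supremum of the lengths of
`M`-regular sequences contained in the maximal ideal. -/
noncomputable def depth [IsLocalRing R] (M : Type u) [AddCommGroup M] [Module R M] : ℕ∞ :=
  sSup {n : ℕ∞ | ∃ rs : List R, (rs.length : ℕ∞) = n ∧ (∀ x ∈ rs, x ∈ maximalIdeal R) ∧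
    RingTheory.Sequence.IsRegular M rs}

/-- The (Krull) dimension of a module: the Krull dimension of `R` modulo
the annihilator of `M` (`⊥` for the zero module). -/
noncomputable def moduleDim (M : Type u) [AddCommGroup M] [Module R M] : WithBot ℕ∞ :=
  ringKrullDim (R ⧸ Module.annihilator R M)

/-- A finitely generated module over a local ring is Cohen-Macaulay
if its depth equals its dimension. -/
def IsCohenMacaulayModule [IsLocalRing R] (M : Type u) [AddCommGroup M] [Module R M] : Prop :=
  (depth R M : WithBot ℕ∞) = moduleDim R M

/-- A local ring is Cohen-Macaulay if it is so as a module over itself. -/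
def IsCohenMacaulayRing [IsLocalRing R] : Prop := IsCohenMacaulayModule R R

/-- A local ring is Gorenstein if it has finite injective dimension over itself. -/
def IsGorensteinRing : Prop := injDim R R ≠ ⊤

/-! ## Ext, Tor, semidualizing modules -/

/-- `Ext^i_R(A, B)`. -/
noncomputable def ext (i : ℕ) (A B : Type u) [AddCommGroup A] [Module R A]
    [AddCommGroup B] [Module R B] : ModuleCat.{u} R :=
  ((Ext R (ModuleCat.{u} R) i).obj (Opposite.op (ModuleCat.of R A))).obj (ModuleCat.of R B)

/-- `Tor^R_p(A, B)` indexed by `p : ℤ`, with the convention that it vanishes in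
negative degrees. -/
noncomputable def tor (p : ℤ) (A B : Type u) [AddCommGroup A] [Module R A]
    [AddCommGroup B] [Module R B] : ModuleCat.{u} R :=
  if 0 ≤ p then ((Tor (ModuleCat.{u} R) p.toNat).obj (ModuleCat.of R A)).obj (ModuleCat.of R B)
  else ModuleCat.of R PUnit

/-- A finitely generated module `C` is semidualizing if the natural map
`R → Hom_R(C, C)` is bijective and `Ext^i_R(C, C) = 0` for all `i ≥ 1`. -/
def IsSemidualizing (C : Type u) [AddCommGroup C] [Module R C] : Prop :=
  Module.Finite R C ∧
  Function.Bijective (fun r : R => (r • LinearMap.id : C →ₗ[R] C)) ∧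
  ∀ i : ℕ, 1 ≤ i → Subsingleton (ext R i C C)

/-! ## Gorenstein homological classes -/

/-- `N` is Gorenstein injective: it is the kernel of the `0`-th differential of some
exact complex `Y` of injective modules which stays exact under `Hom(I, -)` for every
injective module `I`. (The complex is written cohomologically.) -/
def IsGorensteinInjective (N : Type u) [AddCommGroup N] [Module R N] : Prop :=
  ∃ (Y : ℤ → ModuleCat.{u} R) (d : ∀ i : ℤ, Y i →ₗ[R] Y (i + 1)),
    (∀ i, Module.Injective R (Y i)) ∧
    (∀ i, Function.Exact (d i) (d (i + 1))) ∧
    (∀ (I : ModuleCat.{u} R), Module.Injective R I →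
      ∀ (i : ℤ) (g : I →ₗ[R] Y (i + 1)), (d (i + 1)).comp g = 0 →
        ∃ h : I →ₗ[R] Y i, (d i).comp h = g) ∧
    ∃ ι : N →ₗ[R] Y 0, Function.Injective ι ∧ Function.Exact ι (d 0)

/-- `N` is Gorenstein projective: it is the cokernel of a differential of some
exact complex `X` of projective modules which stays exact under `Hom(-, P)` for
every projective module `P`. -/
def IsGorensteinProjective (N : Type u) [AddCommGroup N] [Module R N] : Prop :=
  ∃ (X : ℤ → ModuleCat.{u} R) (d : ∀ i : ℤ, X i →ₗ[R] X (i + 1)),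
    (∀ i, Module.Projective R (X i)) ∧
    (∀ i, Function.Exact (d i) (d (i + 1))) ∧
    (∀ (P : ModuleCat.{u} R), Module.Projective R P →
      ∀ (i : ℤ) (g : X (i + 1) →ₗ[R] P), g.comp (d i) = 0 →
        ∃ h : X (i + 1 + 1) →ₗ[R] P, h.comp (d (i + 1)) = g) ∧
    ∃ π : X 0 →ₗ[R] N, Function.Surjective π ∧ Function.Exact (d (-1)) π

/-- `N` is Gorenstein flat: it is the cokernel of a differential of some exact
complex `Z` of flat modules which stays exact under `- ⊗ I` for every injective
module `I`. -/
def IsGorensteinFlat (N : Type u) [AddCommGroup N] [Module R N] : Prop :=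
  ∃ (Z : ℤ → ModuleCat.{u} R) (d : ∀ i : ℤ, Z i →ₗ[R] Z (i + 1)),
    (∀ i, Module.Flat R (Z i)) ∧
    (∀ i, Function.Exact (d i) (d (i + 1))) ∧
    (∀ (I : ModuleCat.{u} R), Module.Injective R I →
      ∀ i : ℤ, Function.Exact (LinearMap.rTensor (R := R) I (d i))
        (LinearMap.rTensor (R := R) I (d (i + 1)))) ∧
    ∃ π : Z 0 →ₗ[R] N, Function.Surjective π ∧ Function.Exact (d (-1)) π

/-- Gorenstein injective dimension `Gid_R M`. -/
noncomputable def GinjDim (M : Type u) [AddCommGroup M] [Module R M] : ℕ∞ :=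
  CoresDim R (fun N => IsGorensteinInjective R N) (ModuleCat.of R M)

/-- Gorenstein projective dimension `Gpd_R M`. -/
noncomputable def GprojDim (M : Type u) [AddCommGroup M] [Module R M] : ℕ∞ :=
  ResDim R (fun N => IsGorensteinProjective R N) (ModuleCat.of R M)

/-- Gorenstein flat dimension `Gfd_R M`. -/
noncomputable def GflatDim (M : Type u) [AddCommGroup M] [Module R M] : ℕ∞ :=
  ResDim R (fun N => IsGorensteinFlat R N) (ModuleCat.of R M)

/-! ## `C`-injective, `C`-projective, `C`-flat modules and the `G_C`-classes -/

/-- `N` is `C`-injective if `N ≅ Hom_R(C, I)` for some injective module `I`. -/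
def IsCInjective (C : Type u) [AddCommGroup C] [Module R C]
    (N : Type u) [AddCommGroup N] [Module R N] : Prop :=
  ∃ I : ModuleCat.{u} R, Module.Injective R I ∧ Nonempty (N ≃ₗ[R] (C →ₗ[R] I))

/-- `N` is `C`-projective if `N ≅ C ⊗_R P` for some projective module `P`. -/
def IsCProjective (C : Type u) [AddCommGroup C] [Module R C]
    (N : Type u) [AddCommGroup N] [Module R N] : Prop :=
  ∃ P : ModuleCat.{u} R, Module.Projective R P ∧ Nonempty (N ≃ₗ[R] TensorProduct R C P)

/-- `N` is `C`-flat if `N ≅ C ⊗_R F` for some flat module `F`. -/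
def IsCFlat (C : Type u) [AddCommGroup C] [Module R C]
    (N : Type u) [AddCommGroup N] [Module R N] : Prop :=
  ∃ F : ModuleCat.{u} R, Module.Flat R F ∧ Nonempty (N ≃ₗ[R] TensorProduct R C F)

/-- `C`-injective dimension `cid_R M`. -/
noncomputable def cInjDim (C : Type u) [AddCommGroup C] [Module R C]
    (M : Type u) [AddCommGroup M] [Module R M] : ℕ∞ :=
  CoresDim R (fun N => IsCInjective R C N) (ModuleCat.of R M)

/-- `C`-projective dimension `cpd_R M`. -/
noncomputable def cProjDim (C : Type u) [AddCommGroup C] [Module R C]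
    (M : Type u) [AddCommGroup M] [Module R M] : ℕ∞ :=
  ResDim R (fun N => IsCProjective R C N) (ModuleCat.of R M)

/-- `N` is `G_C`-injective: `N` is the kernel of the `0`-th differential of an exact
complex `Y` (a complete `I_C I`-coresolution) with `Y i` injective in degrees belonging
to the coresolution part and `C`-injective elsewhere, such that `Hom(I', Y)` is exact
for every `C`-injective module `I'`. -/
def IsGCInjective (C : Type u) [AddCommGroup C] [Module R C]
    (N : Type u) [AddCommGroup N] [Module R N] : Prop :=
  ∃ (Y : ℤ → ModuleCat.{u} R) (d : ∀ i : ℤ, Y i →ₗ[R] Y (i + 1)),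
    (∀ i : ℤ, 0 ≤ i → Module.Injective R (Y i)) ∧
    (∀ i : ℤ, i < 0 → IsCInjective R C (Y i)) ∧
    (∀ i, Function.Exact (d i) (d (i + 1))) ∧
    (∀ (I : ModuleCat.{u} R), IsCInjective R C I →
      ∀ (i : ℤ) (g : I →ₗ[R] Y (i + 1)), (d (i + 1)).comp g = 0 →
        ∃ h : I →ₗ[R] Y i, (d i).comp h = g) ∧
    ∃ ι : N →ₗ[R] Y 0, Function.Injective ι ∧ Function.Exact ι (d 0)

/-- `N` is `G_C`-projective: the cokernel of the degree `0` differential of a complete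
`P_C P`-resolution. -/
def IsGCProjective (C : Type u) [AddCommGroup C] [Module R C]
    (N : Type u) [AddCommGroup N] [Module R N] : Prop :=
  ∃ (X : ℤ → ModuleCat.{u} R) (d : ∀ i : ℤ, X i →ₗ[R] X (i + 1)),
    (∀ i : ℤ, i ≤ 0 → Module.Projective R (X i)) ∧
    (∀ i : ℤ, 0 < i → IsCProjective R C (X i)) ∧
    (∀ i, Function.Exact (d i) (d (i + 1))) ∧
    (∀ (Q : ModuleCat.{u} R), IsCProjective R C Q →
      ∀ (i : ℤ) (g : X (i + 1) →ₗ[R] Q), g.comp (d i) = 0 →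
        ∃ h : X (i + 1 + 1) →ₗ[R] Q, h.comp (d (i + 1)) = g) ∧
    ∃ π : X 0 →ₗ[R] N, Function.Surjective π ∧ Function.Exact (d (-1)) π

/-- `N` is `G_C`-flat: the cokernel of the degree `0` differential of a complete
`F_C F`-resolution. -/
def IsGCFlat (C : Type u) [AddCommGroup C] [Module R C]
    (N : Type u) [AddCommGroup N] [Module R N] : Prop :=
  ∃ (Z : ℤ → ModuleCat.{u} R) (d : ∀ i : ℤ, Z i →ₗ[R] Z (i + 1)),
    (∀ i : ℤ, i ≤ 0 → Module.Flat R (Z i)) ∧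
    (∀ i : ℤ, 0 < i → IsCFlat R C (Z i)) ∧
    (∀ i, Function.Exact (d i) (d (i + 1))) ∧
    (∀ (J : ModuleCat.{u} R), IsCInjective R C J →
      ∀ i : ℤ, Function.Exact (LinearMap.rTensor (R := R) J (d i))
        (LinearMap.rTensor (R := R) J (d (i + 1)))) ∧
    ∃ π : Z 0 →ₗ[R] N, Function.Surjective π ∧ Function.Exact (d (-1)) π

/-- `G_C`-injective dimension `Gid_C M`. -/
noncomputable def GCinjDim (C : Type u) [AddCommGroup C] [Module R C]
    (M : Type u) [AddCommGroup M] [Module R M] : ℕ∞ :=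
  CoresDim R (fun N => IsGCInjective R C N) (ModuleCat.of R M)

/-- `G_C`-projective dimension `G_C-pd_R M`. -/
noncomputable def GCprojDim (C : Type u) [AddCommGroup C] [Module R C]
    (M : Type u) [AddCommGroup M] [Module R M] : ℕ∞ :=
  ResDim R (fun N => IsGCProjective R C N) (ModuleCat.of R M)

/-- `G_C`-flat dimension `G_C-fd_R M`. -/
noncomputable def GCflatDim (C : Type u) [AddCommGroup C] [Module R C]
    (M : Type u) [AddCommGroup M] [Module R M] : ℕ∞ :=
  ResDim R (fun N => IsGCFlat R C N) (ModuleCat.of R M)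

end Paper

namespace Pf
open Paper
open CategoryTheory.Abelian

section S0
variable {R : Type u} [CommRing R]
variable {A B C X Y : Type u} [AddCommGroup A] [Module R A] [AddCommGroup B] [Module R B]
  [AddCommGroup C] [Module R C] [AddCommGroup X] [Module R X] [AddCommGroup Y] [Module R Y]

/-- Ext vanishing. -/
def EV (R : Type u) [CommRing R] (i : ℕ) (A B : Type u) [AddCommGroup A] [Module R A]
    [AddCommGroup B] [Module R B] : Prop :=
  ∀ e : Ext.{u} (ModuleCat.of R A) (ModuleCat.of R B) i, e = 0

/-- Short exact sequence of linear maps. -/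
structure SES (f : A →ₗ[R] B) (g : B →ₗ[R] C) : Prop where
  inj : Function.Injective f
  ex : Function.Exact f g
  surj : Function.Surjective g

/-- the associated short complex -/
abbrev SES.sc {f : A →ₗ[R] B} {g : B →ₗ[R] C} (h : SES f g) : ShortComplex (ModuleCat.{u} R) :=
  ShortComplex.mk (ModuleCat.ofHom f) (ModuleCat.ofHom g) (by
    ext x; exact (h.ex (f x)).2 ⟨x, rfl⟩)

theorem SES.se {f : A →ₗ[R] B} {g : B →ₗ[R] C} (h : SES f g) : h.sc.ShortExact := by
  exact ShortComplex.ShortExact.mk' (by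
      rw [ShortComplex.ShortExact.moduleCat_exact_iff_function_exact]; exact h.ex)
      ((ModuleCat.mono_iff_injective _).2 h.inj) ((ModuleCat.epi_iff_surjective _).2 h.surj)

theorem EV.ss {i : ℕ} (h : EV R i A B) :
    Subsingleton (Ext.{u} (ModuleCat.of R A) (ModuleCat.of R B) i) :=
  ⟨fun a b => (h a).trans (h b).symm⟩

theorem SES.zero {f : A →ₗ[R] B} {g : B →ₗ[R] C} (h : SES f g) (x : A) : g (f x) = 0 :=
  (h.ex (f x)).2 ⟨x, rfl⟩

theorem ses_ker {g : B →ₗ[R] C} (h : Function.Surjective g) :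
    SES (LinearMap.ker g).subtype g :=
  ⟨Subtype.val_injective, LinearMap.exact_subtype_ker_map g, h⟩

theorem ses_quot {f : A →ₗ[R] B} (h : Function.Injective f) :
    SES f (LinearMap.range f).mkQ :=
  ⟨h, LinearMap.exact_map_mkQ_range f, Submodule.mkQ_surjective _⟩

theorem ses_sub (S : Submodule R B) : SES S.subtype S.mkQ :=
  ⟨Subtype.val_injective, LinearMap.exact_subtype_mkQ S, Submodule.mkQ_surjective _⟩

-- contravariant
variable {f : A →ₗ[R] B} {g : B →ₗ[R] C} {i : ℕ}

theorem SES.ev_mid (h : SES f g) (hC : EV R i C X) (hA : EV R i A X) : EV R i B X := by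
  intro e
  obtain ⟨x, hx⟩ := Ext.contravariant_sequence_exact₂ h.se (ModuleCat.of R X) e (hA _)
  have := hC x
  subst this
  exact hx.symm.trans (Ext.comp_zero ..)

theorem SES.ev_left (h : SES f g) (hB : EV R i B X) (hC : EV R (i+1) C X) : EV R i A X := by
  intro e
  obtain ⟨x, hx⟩ := Ext.contravariant_sequence_exact₁ h.se (ModuleCat.of R X) e (add_comm 1 i) (hC _)
  have := hB x
  subst this
  exact hx.symm.trans (Ext.comp_zero ..)

theorem SES.ev_right (h : SES f g) (hA : EV R i A X) (hB : EV R (i+1) B X) : EV R (i+1) C X := by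
  intro e
  obtain ⟨x, hx⟩ := Ext.contravariant_sequence_exact₃ h.se (ModuleCat.of R X) e (hB _) (add_comm 1 i)
  have := hA x
  subst this
  exact hx.symm.trans (Ext.comp_zero ..)

-- covariant
theorem SES.ev_mid' (h : SES f g) (hA : EV R i X A) (hC : EV R i X C) : EV R i X B := by
  intro e
  obtain ⟨x, hx⟩ := Ext.covariant_sequence_exact₂ (ModuleCat.of R X) h.se e (hC _)
  have := hA x
  subst this
  exact hx.symm.trans (Ext.zero_comp ..)

theorem SES.ev_right' (h : SES f g) (hB : EV R i X B) (hA : EV R (i+1) X A) : EV R i X C := by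
  intro e
  obtain ⟨x, hx⟩ := Ext.covariant_sequence_exact₃ (ModuleCat.of R X) h.se e rfl (hA _)
  have := hB x
  subst this
  exact hx.symm.trans (Ext.zero_comp ..)

theorem SES.ev_left' (h : SES f g) (hC : EV R i X C) (hB : EV R (i+1) X B) : EV R (i+1) X A := by
  intro e
  obtain ⟨x, hx⟩ := Ext.covariant_sequence_exact₁ (ModuleCat.of R X) h.se e (hB _) rfl
  have := hC x
  subst this
  exact hx.symm.trans (Ext.zero_comp ..)

theorem ev_inj [h : Module.Injective R B] (i : ℕ) : EV R (i+1) A B := by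
  intro e
  have := Module.injective_object_of_injective_module R B
  exact Ext.eq_zero_of_injective e

theorem ev_proj [h : Module.Projective R A] (i : ℕ) : EV R (i+1) A B := by
  intro e
  have : Projective (ModuleCat.of R A) := (IsProjective.iff_projective A).1 h
  exact Ext.eq_zero_of_projective e

theorem ev_retract (s : A →ₗ[R] B) (r : B →ₗ[R] A) (h : r ∘ₗ s = LinearMap.id)
    (hB : EV R i B X) : EV R i A X := by
  intro e
  have h1 : (Ext.mk₀ (ModuleCat.ofHom s)).comp ((Ext.mk₀ (ModuleCat.ofHom r)).comp e (zero_add i)) (zero_add i) = e := by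
    rw [← Ext.comp_assoc (h₁₂ := zero_add 0) (h₂₃ := zero_add i) (h := by simp), Ext.mk₀_comp_mk₀, ← ModuleCat.ofHom_comp, h]
    simp
  rw [← h1, hB (Ext.comp _ e _), Ext.comp_zero]

theorem ev_retract' (s : A →ₗ[R] B) (r : B →ₗ[R] A) (h : r ∘ₗ s = LinearMap.id)
    (hB : EV R i X B) : EV R i X A := by
  intro e
  have h1 : ((e.comp (Ext.mk₀ (ModuleCat.ofHom s)) (add_zero i))).comp (Ext.mk₀ (ModuleCat.ofHom r)) (add_zero i) = e := by
    rw [Ext.comp_assoc (h₁₂ := add_zero i) (h₂₃ := zero_add 0) (h := by simp), Ext.mk₀_comp_mk₀, ← ModuleCat.ofHom_comp, h]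
    simp
  rw [← h1, hB (e.comp _ _), Ext.zero_comp]

theorem ev_congr (e : A ≃ₗ[R] B) (hB : EV R i B X) : EV R i A X :=
  ev_retract e.toLinearMap e.symm.toLinearMap (by ext; simp) hB

theorem ev_congr' (e : A ≃ₗ[R] B) (hB : EV R i X B) : EV R i X A :=
  ev_retract' e.toLinearMap e.symm.toLinearMap (by ext; simp) hB

theorem ev_zero_iff : EV R 0 A B ↔ ∀ f : A →ₗ[R] B, f = 0 := by
  constructor
  · intro h f
    have h0 := h (Ext.mk₀ (ModuleCat.ofHom f))
    have : Ext.mk₀ (ModuleCat.ofHom f) = Ext.mk₀ (0 : ModuleCat.of R A ⟶ ModuleCat.of R B) := by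
      rw [h0, Ext.mk₀_zero]
    have := (Ext.mk₀_bijective _ _).1 this
    ext x
    exact congrArg (fun (t : ModuleCat.of R A ⟶ ModuleCat.of R B) => t.hom x) this
  · intro h e
    obtain ⟨f, rfl⟩ := (Ext.mk₀_bijective _ _).2 e
    have : f = 0 := by
      ext x
      exact congrArg (fun t => t x) (h f.hom)
    rw [this, Ext.mk₀_zero]

theorem ev_one_ext (h : SES f g) (hC : EV R 1 C X) (φ : A →ₗ[R] X) :
    ∃ ψ : B →ₗ[R] X, ψ ∘ₗ f = φ := by
  obtain ⟨x, hx⟩ := Ext.contravariant_sequence_exact₁ h.se (ModuleCat.of R X)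
    (Ext.mk₀ (ModuleCat.ofHom φ)) (add_comm 1 0) (hC _)
  obtain ⟨ψ, rfl⟩ := (Ext.mk₀_bijective _ _).2 x
  erw [Ext.mk₀_comp_mk₀] at hx
  have := (Ext.mk₀_bijective _ _).1 hx
  exact ⟨ψ.hom, by ext x; exact congrArg (fun t => t.hom x) this⟩

theorem ev_one_of_ext (h : SES f g) (hB : EV R 1 B X)
    (hext : ∀ φ : A →ₗ[R] X, ∃ ψ : B →ₗ[R] X, ψ ∘ₗ f = φ) : EV R 1 C X := by
  intro e
  obtain ⟨x, hx⟩ := Ext.contravariant_sequence_exact₃ h.se (ModuleCat.of R X) e (hB _) (add_comm 1 0)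
  obtain ⟨φ, rfl⟩ := (Ext.mk₀_bijective _ _).2 x
  obtain ⟨ψ, hψ⟩ := hext φ.hom
  have : φ = h.sc.f ≫ ModuleCat.ofHom ψ := by
    ext x; exact congrArg (fun t => t x) hψ.symm
  rw [← hx, this, ← Ext.mk₀_comp_mk₀, ← Ext.comp_assoc (h₁₂ := add_zero 1) (h₂₃ := zero_add 0) (h := by simp), h.se.extClass_comp, Ext.zero_comp]

theorem ev_one_lift (h : SES f g) (hA : EV R 1 X A) (φ : X →ₗ[R] C) :
    ∃ ψ : X →ₗ[R] B, g ∘ₗ ψ = φ := by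
  obtain ⟨x, hx⟩ := Ext.covariant_sequence_exact₃ (ModuleCat.of R X) h.se
    (Ext.mk₀ (ModuleCat.ofHom φ)) (zero_add 1) (hA _)
  obtain ⟨ψ, rfl⟩ := (Ext.mk₀_bijective _ _).2 x
  erw [Ext.mk₀_comp_mk₀] at hx
  have := (Ext.mk₀_bijective _ _).1 hx
  exact ⟨ψ.hom, by ext x; exact congrArg (fun t => t.hom x) this⟩

theorem ev_one_of_lift (h : SES f g) (hB : EV R 1 X B)
    (hext : ∀ φ : X →ₗ[R] C, ∃ ψ : X →ₗ[R] B, g ∘ₗ ψ = φ) : EV R 1 X A := by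
  intro e
  obtain ⟨x, hx⟩ := Ext.covariant_sequence_exact₁ (ModuleCat.of R X) h.se e (hB _) (zero_add 1)
  obtain ⟨φ, rfl⟩ := (Ext.mk₀_bijective _ _).2 x
  obtain ⟨ψ, hψ⟩ := hext φ.hom
  have : φ = ModuleCat.ofHom ψ ≫ h.sc.g := by
    ext x; exact congrArg (fun t => t x) hψ.symm
  rw [← hx, this, ← Ext.mk₀_comp_mk₀, Ext.comp_assoc (h₁₂ := add_zero 0) (h₂₃ := zero_add 1) (h := by simp), h.se.comp_extClass, Ext.comp_zero]

end S0
end Pf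

namespace Pf
open Paper
open CategoryTheory.Abelian

section S1
variable {R : Type u} [CommRing R]

theorem SES.ev_zero_right {A B C X : Type u} [AddCommGroup A] [Module R A] [AddCommGroup B]
    [Module R B] [AddCommGroup C] [Module R C] [AddCommGroup X] [Module R X]
    {f : A →ₗ[R] B} {g : B →ₗ[R] C} (h : SES f g) (hB : EV R 0 B X) : EV R 0 C X := by
  rw [ev_zero_iff] at *
  intro φ
  have := hB (φ ∘ₗ g)
  ext c
  obtain ⟨b, rfl⟩ := h.surj c
  exact congrArg (fun t => t b) this

/-- free cover -/
noncomputable abbrev fcov (R : Type u) [CommRing R] (A : Type u) [AddCommGroup A] [Module R A] :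
    (A →₀ R) →ₗ[R] A := Finsupp.linearCombination R (id : A → A)

theorem fcov_surj (A : Type u) [AddCommGroup A] [Module R A] :
    Function.Surjective (fcov R A) := Finsupp.linearCombination_id_surjective R A

theorem fcov_ses (A : Type u) [AddCommGroup A] [Module R A] :
    SES (A := LinearMap.ker (fcov R A)) (LinearMap.ker (fcov R A)).subtype (fcov R A) := ses_ker (fcov_surj A)

theorem exists_inj (A : Type u) [AddCommGroup A] [Module R A] :
    ∃ (I : ModuleCat.{u} R) (f : A →ₗ[R] I), Module.Injective R I ∧ Function.Injective f := by
  refine ⟨Injective.under (ModuleCat.of R A), (Injective.ι (ModuleCat.of R A)).hom, ?_, ?_⟩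
  · exact (Module.injective_iff_injective_object R _).2 (inferInstanceAs (Injective (Injective.under (ModuleCat.of R A))))
  · exact (ModuleCat.mono_iff_injective _).1 inferInstance

theorem injective_retract {A B : Type u} [AddCommGroup A] [Module R A] [AddCommGroup B] [Module R B]
    (s : A →ₗ[R] B) (r : B →ₗ[R] A) (h : r ∘ₗ s = LinearMap.id) (hB : Module.Injective R B) :
    Module.Injective R A := by
  refine ⟨fun X Y _ _ _ _ f hf g => ?_⟩
  obtain ⟨k, hk⟩ := hB.out f hf (s ∘ₗ g)
  refine ⟨r ∘ₗ k, fun x => ?_⟩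
  have := congrArg r (hk x)
  rw [LinearMap.comp_apply, this]
  exact congrArg (fun t => t (g x)) h

theorem injective_congr {A B : Type u} [AddCommGroup A] [Module R A] [AddCommGroup B] [Module R B]
    (e : A ≃ₗ[R] B) (hB : Module.Injective R B) : Module.Injective R A :=
  injective_retract e.toLinearMap e.symm.toLinearMap (by ext; simp) hB

theorem injective_of_ev {A : Type u} [AddCommGroup A] [Module R A]
    (h : ∀ (C : Type u) [AddCommGroup C] [Module R C], EV R 1 C A) : Module.Injective R A := by
  obtain ⟨I, f, hI, hf⟩ := exists_inj (R := R) A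
  obtain ⟨r, hr⟩ := ev_one_ext (ses_quot hf) (h _) LinearMap.id
  exact injective_retract f r hr hI

theorem projective_of_ev {A : Type u} [AddCommGroup A] [Module R A]
    (h : ∀ (C : Type u) [AddCommGroup C] [Module R C], EV R 1 A C) : Module.Projective R A := by
  obtain ⟨r, hr⟩ := ev_one_lift (fcov_ses (R := R) A) (h _) LinearMap.id
  exact Module.Projective.of_split r (fcov R A) hr

theorem ev_of_resDimLE (k : ℕ) : ∀ (N : ModuleCat.{u} R),
    ResDimLE R (fun N => Module.Projective R N) k N →
    ∀ (K : Type u) [AddCommGroup K] [Module R K] (i : ℕ), k < i → EV R i N K := by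
  induction k with
  | zero =>
    intro N hN K _ _ i hi
    have : Module.Projective R N := hN
    obtain ⟨i, rfl⟩ := Nat.exists_eq_succ_of_ne_zero hi.ne'
    exact ev_proj i
  | succ k ih =>
    rintro N (hN | ⟨X, f, hX, hf, hk⟩) K _ _ i hi
    · exact ih N hN K i (by omega)
    · obtain ⟨i, rfl⟩ := Nat.exists_eq_succ_of_ne_zero (show i ≠ 0 by omega)
      exact (ses_ker hf).ev_right (ih _ hk K i (by omega)) (ev_proj i)

theorem resDimLE_of_ev (k : ℕ) : ∀ (N : ModuleCat.{u} R),
    (∀ (K : Type u) [AddCommGroup K] [Module R K] (i : ℕ), k < i → EV R i N K) →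
    ResDimLE R (fun N => Module.Projective R N) k N := by
  induction k with
  | zero =>
    intro N h
    exact projective_of_ev (fun C _ _ => h C 1 (by omega))
  | succ k ih =>
    intro N h
    refine Or.inr ⟨ModuleCat.of R (N →₀ R), fcov R N, inferInstance, fcov_surj _, ih _ ?_⟩
    intro K _ _ i hi
    obtain ⟨i, rfl⟩ := Nat.exists_eq_succ_of_ne_zero (show i ≠ 0 by omega)
    exact (fcov_ses (R := R) N).ev_left (ev_proj _) (h K _ (by omega))

theorem ev_of_coresDimLE (k : ℕ) : ∀ (N : ModuleCat.{u} R),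
    CoresDimLE R (fun N => Module.Injective R N) k N →
    ∀ (K : Type u) [AddCommGroup K] [Module R K] (i : ℕ), k < i → EV R i K N := by
  induction k with
  | zero =>
    intro N hN K _ _ i hi
    have : Module.Injective R N := hN
    obtain ⟨i, rfl⟩ := Nat.exists_eq_succ_of_ne_zero hi.ne'
    exact ev_inj i
  | succ k ih =>
    rintro N (hN | ⟨X, f, hX, hf, hk⟩) K _ _ i hi
    · exact ih N hN K i (by omega)
    · obtain ⟨i, rfl⟩ := Nat.exists_eq_succ_of_ne_zero (show i ≠ 0 by omega)
      exact (ses_quot hf).ev_left' (ih _ hk K i (by omega)) (ev_inj i)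

theorem coresDimLE_of_ev (k : ℕ) : ∀ (N : ModuleCat.{u} R),
    (∀ (K : Type u) [AddCommGroup K] [Module R K] (i : ℕ), k < i → EV R i K N) →
    CoresDimLE R (fun N => Module.Injective R N) k N := by
  induction k with
  | zero =>
    intro N h
    exact injective_of_ev (fun C _ _ => h C 1 (by omega))
  | succ k ih =>
    intro N h
    obtain ⟨I, f, hI, hf⟩ := exists_inj (R := R) N
    refine Or.inr ⟨I, f, hI, hf, ih _ ?_⟩
    intro K _ _ i hi
    obtain ⟨i, rfl⟩ := Nat.exists_eq_succ_of_ne_zero (show i ≠ 0 by omega)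
    exact (ses_quot hf).ev_right' (ev_inj _) (h K _ (by omega))

theorem sInf_ne_top_iff (P : ℕ → Prop) :
    sInf {n : ℕ∞ | ∃ k : ℕ, (k : ℕ∞) = n ∧ P k} ≠ ⊤ ↔ ∃ k, P k := by
  constructor
  · intro h
    by_contra hc
    push Not at hc
    apply h
    rw [sInf_eq_top]
    rintro _ ⟨k, rfl, hk⟩
    exact absurd hk (hc k)
  · rintro ⟨k, hk⟩ h
    rw [sInf_eq_top] at h
    exact absurd (h _ ⟨k, rfl, hk⟩) (ENat.natCast_ne_top k)

theorem projDim_iff (M : Type u) [AddCommGroup M] [Module R M] : projDim R M ≠ ⊤ ↔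
    ∃ s, ∀ (K : Type u) [AddCommGroup K] [Module R K] (i : ℕ), s < i → EV R i M K := by
  refine (sInf_ne_top_iff _).trans ⟨?_, ?_⟩
  · rintro ⟨k, hk⟩
    exact ⟨k, ev_of_resDimLE k _ hk⟩
  · rintro ⟨k, hk⟩
    exact ⟨k, resDimLE_of_ev k _ hk⟩

theorem injDim_iff (M : Type u) [AddCommGroup M] [Module R M] : injDim R M ≠ ⊤ ↔
    ∃ s, ∀ (K : Type u) [AddCommGroup K] [Module R K] (i : ℕ), s < i → EV R i K M := by
  refine (sInf_ne_top_iff _).trans ⟨?_, ?_⟩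
  · rintro ⟨k, hk⟩
    exact ⟨k, ev_of_coresDimLE k _ hk⟩
  · rintro ⟨k, hk⟩
    exact ⟨k, coresDimLE_of_ev k _ hk⟩

theorem ses_finsupp {A B C : Type u} [AddCommGroup A] [Module R A] [AddCommGroup B]
    [Module R B] [AddCommGroup C] [Module R C] {f : A →ₗ[R] B} {g : B →ₗ[R] C} (h : SES f g) :
    SES (Finsupp.mapRange.linearMap f : (ℕ →₀ A) →ₗ[R] _) (Finsupp.mapRange.linearMap g : (ℕ →₀ B) →ₗ[R] _) := by
  refine ⟨?_, ?_, ?_⟩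
  · exact Finsupp.mapRange_injective f (map_zero f) h.inj
  · rw [LinearMap.exact_iff, Finsupp.ker_mapRange, Finsupp.range_mapRange_linearMap _ (LinearMap.ker_eq_bot.2 h.inj), (LinearMap.exact_iff).1 h.ex]
  · exact Finsupp.mapRange_surjective g (map_zero g) h.surj

theorem ev_finsupp (K : Type u) [AddCommGroup K] [Module R K] (i : ℕ) : ∀ (A : Type u)
    [AddCommGroup A] [Module R A], EV R i A K → EV R i (ℕ →₀ A) K := by
  induction i with
  | zero =>
    intro A _ _ h
    rw [ev_zero_iff] at *
    intro f
    apply Finsupp.lhom_ext'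
    intro n
    rw [h (f ∘ₗ Finsupp.lsingle n), LinearMap.zero_comp]
  | succ i ih =>
    intro A _ _ h
    have hs := ses_finsupp (fcov_ses (R := R) A)
    rcases Nat.eq_zero_or_pos i with rfl | hi
    · refine ev_one_of_ext hs (ev_proj 0) ?_
      intro φ
      choose ψ hψ using fun n => ev_one_ext (fcov_ses (R := R) A) h (φ ∘ₗ Finsupp.lsingle n)
      refine ⟨Finsupp.lsum R ψ, ?_⟩
      apply Finsupp.lhom_ext'
      intro n
      rw [← hψ n]
      ext x
      simp
    · obtain ⟨i, rfl⟩ := Nat.exists_eq_succ_of_ne_zero hi.ne'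
      refine hs.ev_right (ih _ ((fcov_ses (R := R) A).ev_left (ev_proj _) h)) (ev_proj _)

end S1
end Pf

namespace Pf
open Paper
open CategoryTheory.Abelian

section S2
variable {R : Type u} [CommRing R]

theorem injective_prod {A B : Type u} [AddCommGroup A] [Module R A] [AddCommGroup B] [Module R B]
    (hA : Module.Injective R A) (hB : Module.Injective R B) : Module.Injective R (A × B) := by
  refine ⟨fun X Y _ _ _ _ f hf g => ?_⟩
  obtain ⟨k, hk⟩ := hA.out f hf (LinearMap.fst R A B ∘ₗ g)
  obtain ⟨l, hl⟩ := hB.out f hf (LinearMap.snd R A B ∘ₗ g)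
  exact ⟨k.prod l, fun x => Prod.ext (hk x) (hl x)⟩

/-- iterated injective left resolution property -/
def GI (T : ModuleCat.{u} R → Prop) : ℕ → ModuleCat.{u} R → Prop
  | 0, G => T G
  | m + 1, G => T G ∧ ∃ (E : ModuleCat.{u} R) (g : E →ₗ[R] G), Module.Injective R E ∧
      Function.Surjective g ∧ GI T m (ModuleCat.of R (LinearMap.ker g))

/-- admissible classes -/
structure Good (T : ModuleCat.{u} R → Prop) : Prop where
  iso : ∀ (A B : Type u) [AddCommGroup A] [Module R A] [AddCommGroup B] [Module R B],
    (A ≃ₗ[R] B) → T (ModuleCat.of R A) → T (ModuleCat.of R B)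
  ext : ∀ (A B C : Type u) [AddCommGroup A] [Module R A] [AddCommGroup B] [Module R B]
    [AddCommGroup C] [Module R C] (f : A →ₗ[R] B) (g : B →ₗ[R] C), SES f g →
    T (ModuleCat.of R A) → T (ModuleCat.of R C) → T (ModuleCat.of R B)
  ev : ∀ (A : Type u) [AddCommGroup A] [Module R A], T (ModuleCat.of R A) →
    ∀ (I : Type u) [AddCommGroup I] [Module R I], Module.Injective R I → EV R 1 I A

variable {T : ModuleCat.{u} R → Prop}

theorem GI.base {m : ℕ} {G : ModuleCat.{u} R} (h : GI T m G) : T G := by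
  cases m with
  | zero => exact h
  | succ m => exact h.1

theorem GI_iso (hT : Good T) {m : ℕ} {A B : Type u} [AddCommGroup A] [Module R A] [AddCommGroup B]
    [Module R B] (e : A ≃ₗ[R] B) (h : GI T m (ModuleCat.of R A)) : GI T m (ModuleCat.of R B) := by
  cases m with
  | zero => exact hT.iso A B e h
  | succ m =>
    obtain ⟨h0, E, g, hE, hg, hk⟩ := h
    refine ⟨hT.iso A B e h0, E, e.toLinearMap ∘ₗ g, hE, e.surjective.comp hg, ?_⟩
    have : LinearMap.ker (e.toLinearMap ∘ₗ g) = LinearMap.ker g := LinearEquiv.ker_comp e g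
    rw [this]
    exact hk

theorem GI_ext (hT : Good T) (m : ℕ) : ∀ {A B C : Type u} [AddCommGroup A] [Module R A]
    [AddCommGroup B] [Module R B]
    [AddCommGroup C] [Module R C] (f : A →ₗ[R] B) (g : B →ₗ[R] C), SES f g →
    GI T m (ModuleCat.of R A) → GI T m (ModuleCat.of R C) → GI T m (ModuleCat.of R B) := by
  induction m with
  | zero => intro A B C _ _ _ _ _ _ f g h hA hC; exact hT.ext A B C f g h hA hC
  | succ m ih =>
    rintro A B C _ _ _ _ _ _ f g h ⟨hA, E₁, a, hE₁, ha, hka⟩ ⟨hC, E₂, c, hE₂, hc, hkc⟩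
    refine ⟨hT.ext A B C f g h hA hC, ?_⟩
    obtain ⟨c', hc'⟩ := ev_one_lift h (hT.ev A hA E₂ hE₂) c
    have hc'' : ∀ y, g (c' y) = c y := fun y => congrArg (fun t => t y) hc'
    let β : (E₁ × E₂) →ₗ[R] B := (f ∘ₗ a).coprod c'
    have hβ : ∀ x y, β (x, y) = f (a x) + c' y := fun x y => by simp [β]
    refine ⟨ModuleCat.of R (E₁ × E₂), β, injective_prod hE₁ hE₂, ?_, ?_⟩
    · intro b
      obtain ⟨y, hy⟩ := hc (g b)
      have h1 : g (b - c' y) = 0 := by rw [map_sub, hc'', hy, sub_self]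
      obtain ⟨x, hx⟩ := (h.ex _).1 h1
      obtain ⟨z, rfl⟩ := ha x
      refine ⟨(z, y), ?_⟩
      rw [hβ, hx]; abel
    · let u : LinearMap.ker a →ₗ[R] LinearMap.ker β :=
        LinearMap.codRestrict _ (LinearMap.inl R E₁ E₂ ∘ₗ (LinearMap.ker a).subtype) (by
          rintro ⟨x, hx⟩
          have hx' : a x = 0 := hx
          change β (x, 0) = 0
          rw [hβ, hx']; simp)
      let v : LinearMap.ker β →ₗ[R] LinearMap.ker c :=
        LinearMap.codRestrict _ (LinearMap.snd R E₁ E₂ ∘ₗ (LinearMap.ker β).subtype) (by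
          rintro ⟨⟨x, y⟩, hx⟩
          have hx' : β (x, y) = 0 := hx
          rw [hβ] at hx'
          have := congrArg g hx'
          rw [map_add, h.zero, hc'', zero_add, map_zero] at this
          exact this)
      refine ih u v ⟨?_, ?_, ?_⟩ hka hkc
      · rintro ⟨x, hx⟩ ⟨y, hy⟩ hxy
        have := congrArg (fun t => t.1.1) hxy
        exact Subtype.ext this
      · rintro ⟨⟨x, y⟩, hx⟩
        constructor
        · intro hy
          have hy' : y = 0 := congrArg Subtype.val hy
          subst hy'
          have hx' : β (x, 0) = 0 := hx
          rw [hβ, map_zero, add_zero] at hx'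
          exact ⟨⟨x, h.inj (by rw [hx', map_zero])⟩, rfl⟩
        · rintro ⟨⟨z, hz⟩, hzz⟩
          have := congrArg (fun t => t.1.2) hzz
          exact Subtype.ext this.symm
      · rintro ⟨y, hy⟩
        have hy' : c y = 0 := hy
        have h1 : g (c' y) = 0 := by rw [hc'', hy']
        obtain ⟨x, hx⟩ := (h.ex _).1 h1
        obtain ⟨z, rfl⟩ := ha x
        refine ⟨⟨(-z, y), ?_⟩, rfl⟩
        change β (-z, y) = 0
        rw [hβ, map_neg, map_neg, hx]; simp

theorem lemmaL_b (hT : Good T) (P : ModuleCat.{u} R → Prop) (hP : ∀ X, P X → ∀ m, GI T m X)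
    (d : ℕ) : ∀ (N : ModuleCat.{u} R), CoresDimLE R P d N → ∀ m : ℕ,
    ∃ (X : ModuleCat.{u} R) (p : X →ₗ[R] N), Function.Surjective p ∧
      GI T m (ModuleCat.of R (LinearMap.ker p)) ∧
      ∃ b : ℕ, ∀ (A : Type u) [AddCommGroup A] [Module R A] (i : ℕ), b < i → EV R i A X := by
  induction d with
  | zero =>
    intro N hN m
    obtain ⟨-, E, g, hE, hg, hk⟩ := hP N hN (m+1)
    refine ⟨E, g, hg, hk, 0, ?_⟩
    intro A _ _ i hi
    obtain ⟨i, rfl⟩ := Nat.exists_eq_succ_of_ne_zero hi.ne'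
    exact ev_inj i
  | succ d ih =>
    rintro N (hN | ⟨G, f, hG, hf, hd⟩) m
    · exact ih N hN m
    obtain ⟨X', p', hp', hk', b, hb⟩ := ih _ hd (m+1)
    let W : Submodule R (G × X') :=
      LinearMap.ker ((LinearMap.range f).mkQ ∘ₗ LinearMap.fst R G X' - p' ∘ₗ LinearMap.snd R G X')
    have hW : ∀ g x, (g, x) ∈ W ↔ (LinearMap.range f).mkQ g = p' x := by
      intro g x
      simp only [W, LinearMap.mem_ker, LinearMap.sub_apply, LinearMap.comp_apply, sub_eq_zero]
      rfl
    have hWG : GI T (m+1) (ModuleCat.of R W) := by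
      let u : LinearMap.ker p' →ₗ[R] W :=
        LinearMap.codRestrict _ (LinearMap.inr R G X' ∘ₗ (LinearMap.ker p').subtype) (by
          rintro ⟨x, hx⟩
          have hx' : p' x = 0 := hx
          change ((0 : G), x) ∈ W
          rw [hW, hx', map_zero])
      refine GI_ext hT (m+1) u (LinearMap.fst R G X' ∘ₗ W.subtype) ⟨?_, ?_, ?_⟩ hk' (hP G hG (m+1))
      · rintro ⟨x, hx⟩ ⟨y, hy⟩ hxy
        have := congrArg (fun t => t.1.2) hxy
        exact Subtype.ext this
      · rintro ⟨⟨g, x⟩, hx⟩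
        constructor
        · intro hg
          have hg' : g = 0 := hg
          subst hg'
          rw [hW, map_zero] at hx
          exact ⟨⟨x, hx.symm⟩, rfl⟩
        · rintro ⟨⟨z, hz⟩, hzz⟩
          have := congrArg (fun t => t.1.1) hzz
          exact this.symm
      · intro g
        obtain ⟨x, hx⟩ := hp' ((LinearMap.range f).mkQ g)
        exact ⟨⟨(g, x), (hW _ _).2 hx.symm⟩, rfl⟩
    obtain ⟨-, E, e, hE, he, hke⟩ := hWG
    let q : E →ₗ[R] X' := LinearMap.snd R G X' ∘ₗ W.subtype ∘ₗ e
    have hq : Function.Surjective q := by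
      intro x
      obtain ⟨g, hg⟩ := Submodule.mkQ_surjective _ (p' x)
      obtain ⟨z, hz⟩ := he ⟨(g, x), (hW _ _).2 hg⟩
      refine ⟨z, ?_⟩
      change (e z).1.2 = x
      rw [hz]
    let r : LinearMap.ker q →ₗ[R] LinearMap.range f :=
      LinearMap.codRestrict _ (LinearMap.fst R G X' ∘ₗ W.subtype ∘ₗ e ∘ₗ (LinearMap.ker q).subtype) (by
        rintro ⟨x, hx⟩
        have hx' : (e x).1.2 = 0 := hx
        change (e x).1.1 ∈ _
        have h1 := (hW (e x).1.1 (e x).1.2).1 (e x).2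
        rw [hx', map_zero] at h1
        exact (Submodule.Quotient.mk_eq_zero _).1 h1)
    let p : LinearMap.ker q →ₗ[R] N := (LinearEquiv.ofInjective f hf).symm.toLinearMap ∘ₗ r
    refine ⟨ModuleCat.of R (LinearMap.ker q), p, ?_, ?_, b + 1, ?_⟩
    · refine (LinearEquiv.ofInjective f hf).symm.surjective.comp ?_
      rintro ⟨_, ⟨y, rfl⟩⟩
      obtain ⟨z, hz⟩ := he ⟨(f y, 0), (hW _ _).2 (by
        rw [map_zero]; exact (Submodule.Quotient.mk_eq_zero _).2 ⟨y, rfl⟩)⟩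
      refine ⟨⟨z, ?_⟩, ?_⟩
      · change (e z).1.2 = 0
        rw [hz]
      · apply Subtype.ext
        change (e z).1.1 = f y
        rw [hz]
    · have hkr : LinearMap.ker p = LinearMap.ker r := LinearEquiv.ker_comp _ r
      rw [hkr]
      refine GI_iso hT ?_ hke
      refine LinearEquiv.ofBijective (LinearMap.codRestrict _ (LinearMap.codRestrict (LinearMap.ker q) (LinearMap.ker e).subtype ?_) ?_) ⟨?_, ?_⟩
      · rintro ⟨x, hx⟩
        have hx' : e x = 0 := hx
        change (e x).1.2 = 0
        rw [hx']; rfl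
      · rintro ⟨x, hx⟩
        have hx' : e x = 0 := hx
        apply Subtype.ext
        change (e x).1.1 = 0
        rw [hx']; rfl
      · rintro ⟨x, hx⟩ ⟨y, hy⟩ hxy
        have := congrArg (fun t => t.1.1) hxy
        exact Subtype.ext this
      · rintro ⟨⟨x, hx⟩, hx2⟩
        refine ⟨⟨x, ?_⟩, rfl⟩
        have h1 : (e x).1.2 = 0 := hx
        have h2 : (e x).1.1 = 0 := congrArg Subtype.val hx2
        exact Subtype.ext (Prod.ext h2 h1)
    · intro A _ _ i hi
      obtain ⟨i, rfl⟩ := Nat.exists_eq_succ_of_ne_zero (show i ≠ 0 by omega)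
      exact (ses_ker hq).ev_left' (hb A i (by omega)) (ev_inj i)

theorem GI_ev (N : Type u) [AddCommGroup N] [Module R N] (j : ℕ) : ∀ (K : ModuleCat.{u} R) (r : ℕ),
    (∀ K' : ModuleCat.{u} R, T K' → EV R (r + j + 1) N K') → GI T j K → EV R (r + 1) N K := by
  induction j with
  | zero => intro K r h hK; exact h K hK
  | succ j ih =>
    rintro K r h ⟨-, E, g, hE, hg, hk⟩
    exact (ses_ker hg).ev_right' (ev_inj r) (ih _ (r+1) (fun K' h' => by
      have := h K' h'
      rwa [show r + 1 + j + 1 = r + (j + 1) + 1 by omega]) hk)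

theorem lemmaL (hT : Good T) (P : ModuleCat.{u} R → Prop) (hP : ∀ X, P X → ∀ m, GI T m X)
    (d : ℕ) (N : ModuleCat.{u} R) (hN : CoresDimLE R P d N) (s : ℕ)
    (hs : ∀ K : ModuleCat.{u} R, T K → EV R (s + 1) N K) :
    ∃ b : ℕ, ∀ (A : Type u) [AddCommGroup A] [Module R A] (i : ℕ), b < i → EV R i A N := by
  obtain ⟨X, p, hp, hk, b, hb⟩ := lemmaL_b hT P hP d N hN s
  have h1 : EV R 1 N (LinearMap.ker p) := GI_ev N s _ 0 (fun K' h' => by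
    have := hs K' h'
    rwa [zero_add]) hk
  obtain ⟨ψ, hψ⟩ := ev_one_lift (ses_ker hp) h1 LinearMap.id
  exact ⟨b, fun A _ _ i hi => ev_retract' ψ p hψ (hb A i hi)⟩

/-- class used for Gorenstein injectives -/
def TI (R : Type u) [CommRing R] (G : ModuleCat.{u} R) : Prop :=
  ∀ (I : Type u) [AddCommGroup I] [Module R I], Module.Injective R I → ∀ i, EV R (i + 1) I G

theorem good_TI : Good (TI R) where
  iso A B _ _ _ _ e h I _ _ hI i := ev_congr' e.symm (h I hI i)
  ext A B C _ _ _ _ _ _ f g hs hA hC I _ _ hI i := hs.ev_mid' (hA I hI i) (hC I hI i)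
  ev A _ _ h I _ _ hI := h I hI 0

theorem gorinj_left (Y : ℤ → ModuleCat.{u} R) (d : ∀ i : ℤ, Y i →ₗ[R] Y (i + 1))
    (hY : ∀ i, Module.Injective R (Y i))
    (hex : ∀ i, Function.Exact (d i) (d (i + 1)))
    (hl : ∀ (I : ModuleCat.{u} R), Module.Injective R I →
      ∀ (i : ℤ) (g : I →ₗ[R] Y (i + 1)), (d (i + 1)).comp g = 0 →
        ∃ h : I →ₗ[R] Y i, (d i).comp h = g)
    (k : ℤ) (N : Type u) [AddCommGroup N] [Module R N] (ι : N →ₗ[R] Y k)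
    (hι : Function.Injective ι) (hιe : Function.Exact ι (d k)) :
    (∀ (I : Type u) [AddCommGroup I] [Module R I], Module.Injective R I → EV R 1 I N) ∧
    ∃ (j : ℤ) (g : Y j →ₗ[R] N), Function.Surjective g ∧
      Function.Exact (LinearMap.ker g).subtype (d j) := by
  obtain ⟨j, rfl⟩ : ∃ j, k = j + 1 := ⟨k - 1, by ring⟩
  let r : Y j →ₗ[R] N := (LinearEquiv.ofInjective ι hι).symm.toLinearMap ∘ₗ
    LinearMap.codRestrict (LinearMap.range ι) (d j) (fun x => (hιe _).1 ((hex j _).2 ⟨x, rfl⟩))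
  have hr : ∀ x, ι (r x) = d j x := by
    intro x
    have := (LinearEquiv.ofInjective ι hι).apply_symm_apply
      (LinearMap.codRestrict (LinearMap.range ι) (d j) (fun x => (hιe _).1 ((hex j _).2 ⟨x, rfl⟩)) x)
    exact congrArg Subtype.val this
  have hrs : Function.Surjective r := by
    intro y
    obtain ⟨x, hx⟩ := (hex j (ι y)).1 ((hιe _).2 ⟨y, rfl⟩)
    exact ⟨x, hι (by rw [hr, hx])⟩
  constructor
  · intro I _ _ hI
    refine ev_one_of_lift (f := ι) (g := LinearMap.rangeRestrict (d (j+1))) ⟨hι, ?_, ?_⟩ (ev_inj 0) ?_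
    · intro y
      rw [← hιe y]
      exact Subtype.ext_iff
    · exact LinearMap.surjective_rangeRestrict _
    · intro φ
      obtain ⟨h, hh⟩ := hl (ModuleCat.of R I) hI (j+1) ((LinearMap.range (d (j+1))).subtype ∘ₗ φ) (by
        ext x
        obtain ⟨z, hz⟩ := (φ x).2
        change d (j+1+1) (φ x).1 = 0
        rw [← hz]
        exact (hex (j+1) _).2 ⟨z, rfl⟩)
      refine ⟨h, ?_⟩
      ext x
      exact congrArg (fun t => t x) hh
  · refine ⟨j, r, hrs, ?_⟩
    intro y
    rw [Submodule.coe_subtype, Subtype.range_coe, ← hr y]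
    constructor
    · intro h; exact hι (by rw [h, map_zero])
    · intro h
      have h' : r y = 0 := h
      rw [h', map_zero]

theorem gorinj_TI (Y : ℤ → ModuleCat.{u} R) (d : ∀ i : ℤ, Y i →ₗ[R] Y (i + 1))
    (hY : ∀ i, Module.Injective R (Y i))
    (hex : ∀ i, Function.Exact (d i) (d (i + 1)))
    (hl : ∀ (I : ModuleCat.{u} R), Module.Injective R I →
      ∀ (i : ℤ) (g : I →ₗ[R] Y (i + 1)), (d (i + 1)).comp g = 0 →
        ∃ h : I →ₗ[R] Y i, (d i).comp h = g)
    (i : ℕ) : ∀ (k : ℤ) (N : Type u) [AddCommGroup N] [Module R N] (ι : N →ₗ[R] Y k)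
    (_ : Function.Injective ι) (_ : Function.Exact ι (d k))
    (I : Type u) [AddCommGroup I] [Module R I], Module.Injective R I → EV R (i + 1) I N := by
  induction i with
  | zero =>
    intro k N _ _ ι hι hιe I _ _ hI
    exact (gorinj_left Y d hY hex hl k N ι hι hιe).1 I hI
  | succ i ih =>
    intro k N _ _ ι hι hιe I _ _ hI
    have hs : SES ι (LinearMap.rangeRestrict (d k)) := ⟨hι, by
      intro y
      rw [← hιe y]
      exact Subtype.ext_iff, LinearMap.surjective_rangeRestrict _⟩
    refine hs.ev_left' (ih (k+1) (LinearMap.range (d k)) (LinearMap.range (d k)).subtype Subtype.val_injective ?_ I hI) (ev_inj _)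
    intro y
    rw [Submodule.coe_subtype, Subtype.range_coe]
    exact hex k y

theorem gorinj_GI (Y : ℤ → ModuleCat.{u} R) (d : ∀ i : ℤ, Y i →ₗ[R] Y (i + 1))
    (hY : ∀ i, Module.Injective R (Y i))
    (hex : ∀ i, Function.Exact (d i) (d (i + 1)))
    (hl : ∀ (I : ModuleCat.{u} R), Module.Injective R I →
      ∀ (i : ℤ) (g : I →ₗ[R] Y (i + 1)), (d (i + 1)).comp g = 0 →
        ∃ h : I →ₗ[R] Y i, (d i).comp h = g)
    (m : ℕ) : ∀ (k : ℤ) (N : Type u) [AddCommGroup N] [Module R N] (ι : N →ₗ[R] Y k)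
    (_ : Function.Injective ι) (_ : Function.Exact ι (d k)), GI (TI R) m (ModuleCat.of R N) := by
  induction m with
  | zero =>
    intro k N _ _ ι hι hιe I _ _ hI i
    exact gorinj_TI Y d hY hex hl i k N ι hι hιe I hI
  | succ m ih =>
    intro k N _ _ ι hι hιe
    refine ⟨fun I _ _ hI i => gorinj_TI Y d hY hex hl i k N ι hι hιe I hI, ?_⟩
    obtain ⟨j, g, hg, hge⟩ := (gorinj_left Y d hY hex hl k N ι hι hιe).2
    exact ⟨Y j, g, hY j, hg, ih j _ _ Subtype.val_injective hge⟩

theorem gorInj_GI (N : ModuleCat.{u} R) (h : IsGorensteinInjective R N) (m : ℕ) : GI (TI R) m N := by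
  obtain ⟨Y, d, hY, hex, hl, ι, hι, hιe⟩ := h
  exact gorinj_GI Y d hY hex hl m 0 N ι hι hιe

theorem GinjDim_lemma (N : ModuleCat.{u} R) (h : GinjDim R N ≠ ⊤) (s : ℕ)
    (hs : ∀ K : ModuleCat.{u} R, TI R K → EV R (s + 1) N K) :
    ∃ b : ℕ, ∀ (A : Type u) [AddCommGroup A] [Module R A] (i : ℕ), b < i → EV R i A N := by
  obtain ⟨d, hd⟩ := (sInf_ne_top_iff _).1 h
  exact lemmaL good_TI _ gorInj_GI d N hd s hs

end S2
end Pf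

namespace Pf
open Paper
open CategoryTheory.Abelian

section S3
variable {R : Type u} [CommRing R]
variable {A B C : Type u} [AddCommGroup A] [Module R A] [AddCommGroup B] [Module R B]
  [AddCommGroup C] [Module R C]

theorem inj_factor {I : Type u} [AddCommGroup I] [Module R I] (hI : Module.Injective R I)
    (f : A →ₗ[R] B) (φ : A →ₗ[R] I) (h : ∀ a, f a = 0 → φ a = 0) :
    ∃ ψ : B →ₗ[R] I, ∀ a, ψ (f a) = φ a := by
  let f' : (A ⧸ LinearMap.ker f) →ₗ[R] B := (LinearMap.ker f).liftQ f le_rfl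
  let φ' : (A ⧸ LinearMap.ker f) →ₗ[R] I := (LinearMap.ker f).liftQ φ h
  obtain ⟨ψ, hψ⟩ := hI.out f' (LinearMap.ker_eq_bot.1 (Submodule.ker_liftQ_eq_bot' _ _ rfl)) φ'
  exact ⟨ψ, fun a => hψ (Submodule.Quotient.mk a)⟩

theorem char_factor (f : A →ₗ[R] B) (χ : CharacterModule A) (h : ∀ a, f a = 0 → χ a = 0) :
    ∃ ψ : CharacterModule B, ∀ a, ψ (f a) = χ a := by
  have hs : Function.Surjective f.rangeRestrict.toAddMonoidHom := LinearMap.surjective_rangeRestrict f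
  let χ' : CharacterModule (LinearMap.range f) :=
    (f.rangeRestrict.toAddMonoidHom).liftOfSurjective hs
      ⟨(χ : A →+ AddCircle (1 : ℚ)), fun a ha => h a (congrArg Subtype.val (show f.rangeRestrict a = 0 from ha))⟩
  obtain ⟨ψ, hψ⟩ := CharacterModule.dual_surjective_of_injective (LinearMap.range f).subtype Subtype.val_injective χ'
  refine ⟨ψ, fun a => ?_⟩
  have h1 : ψ (f a) = χ' (f.rangeRestrict a) := by rw [← hψ]; rfl
  rw [h1]
  exact AddMonoidHom.liftOfRightInverse_comp_apply _ _ _ _ a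

theorem SES.dual {f : A →ₗ[R] B} {g : B →ₗ[R] C} (h : SES f g) :
    SES (CharacterModule.dual g) (CharacterModule.dual f) := by
  refine ⟨CharacterModule.dual_injective_of_surjective g h.surj, ?_,
    CharacterModule.dual_surjective_of_injective f h.inj⟩
  intro χ
  constructor
  · intro hχ
    obtain ⟨ψ, hψ⟩ := char_factor g χ (by
      intro b hb
      obtain ⟨a, rfl⟩ := (h.ex b).1 hb
      exact congrArg (fun t : CharacterModule A => t a) hχ)
    exact ⟨ψ, DFunLike.ext _ _ hψ⟩
  · rintro ⟨ψ, rfl⟩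
    apply CharacterModule.ext
    intro a
    change ψ (g (f a)) = 0
    rw [h.zero, map_zero]

/-- swapping -/
def swp (φ : A →ₗ[R] CharacterModule B) : B →ₗ[R] CharacterModule A where
  toFun b := { toFun := fun a => φ a b, map_zero' := by rw [map_zero]; rfl, map_add' := fun x y => by rw [map_add]; rfl }
  map_add' x y := DFunLike.ext _ _ fun a => map_add (φ a) x y
  map_smul' r x := DFunLike.ext _ _ fun a => by
    change φ a (r • x) = φ (r • a) x
    rw [φ.map_smul]; rfl

theorem swp_apply (φ : A →ₗ[R] CharacterModule B) (b : B) (a : A) : swp φ b a = φ a b := rfl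

theorem injective_dual_flat [Module.Flat R A] : Module.Injective R (CharacterModule A) :=
  Module.Flat.iff_characterModule_injective.1 inferInstance

theorem ev_swap (i : ℕ) : ∀ (A C : Type u) [AddCommGroup A] [Module R A] [AddCommGroup C] [Module R C],
    EV R i A (CharacterModule C) → EV R i C (CharacterModule A) := by
  induction i with
  | zero =>
    intro A C _ _ _ _ h
    rw [ev_zero_iff] at *
    intro f
    have := h (swp f)
    ext c a
    exact congrArg (fun t => t a c) this
  | succ i ih =>
    intro A C _ _ _ _ h
    have hs := fcov_ses (R := R) A
    have : Module.Injective R (CharacterModule (A →₀ R)) := injective_dual_flat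
    rcases Nat.eq_zero_or_pos i with rfl | hi
    · refine ev_one_of_lift hs.dual (ev_inj 0) ?_
      intro φ
      obtain ⟨ψ, hψ⟩ := ev_one_ext hs h (swp φ)
      refine ⟨swp ψ, ?_⟩
      ext c a
      exact congrArg (fun t => t a c) hψ
    · obtain ⟨i, rfl⟩ := Nat.exists_eq_succ_of_ne_zero hi.ne'
      exact hs.dual.ev_left' (ih _ _ (hs.ev_left (ev_proj _) h)) (ev_inj _)

theorem ev_flat [Module.Flat R A] (i : ℕ) : EV R (i+1) A (CharacterModule C) := by
  apply ev_swap
  have : Module.Injective R (CharacterModule A) := injective_dual_flat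
  exact ev_inj i

theorem flat_dual [IsNoetherianRing R] (hA : Module.Injective R A) :
    Module.Flat R (CharacterModule A) := by
  rw [Module.Flat.iff_forall_isTrivialRelation]
  intro l f x hx
  let S : Submodule R (Fin l → R) := LinearMap.ker (Fintype.linearCombination R f)
  obtain ⟨k, a, ha⟩ := Submodule.fg_iff_exists_fin_generating_family.1 (IsNoetherian.noetherian S)
  have haS : ∀ j, ∑ i, f i * a j i = 0 := by
    intro j
    have : a j ∈ S := by rw [← ha]; exact Submodule.subset_span ⟨j, rfl⟩
    have h1 : Fintype.linearCombination R f (a j) = 0 := this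
    rw [Fintype.linearCombination_apply] at h1
    rw [← h1]
    exact Finset.sum_congr rfl fun i _ => mul_comm _ _
  let Φ : (Fin l → A) →ₗ[R] (Fin k → A) :=
    LinearMap.pi fun j => ∑ i, a j i • LinearMap.proj i
  have hΦ : ∀ e j, Φ e j = ∑ i, a j i • e i := by
    intro e j; simp [Φ]
  let χ : CharacterModule (Fin l → A) :=
    (∑ i, (x i).comp (Pi.evalAddMonoidHom (fun _ : Fin l => A) i) : (Fin l → A) →+ AddCircle (1 : ℚ))
  have hχ : ∀ e, χ e = ∑ i, x i (e i) := by
    intro e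
    change (∑ i, (x i).comp (Pi.evalAddMonoidHom (fun _ : Fin l => A) i) : (Fin l → A) →+ AddCircle (1 : ℚ)) e = _
    rw [AddMonoidHom.finsetSum_apply]; rfl
  obtain ⟨ψ, hψ⟩ := char_factor Φ χ (by
    intro e he
    have h1 : ∀ j, ∑ i, a j i • e i = 0 := fun j => by rw [← hΦ, he]; rfl
    obtain ⟨g, hg⟩ := inj_factor hA (Fintype.linearCombination R f) (Fintype.linearCombination R e) (by
      intro s hs
      have hs' : s ∈ S := hs
      have hle : S ≤ LinearMap.ker (Fintype.linearCombination R e) := by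
        rw [← ha, Submodule.span_le]
        rintro _ ⟨j, rfl⟩
        change Fintype.linearCombination R e (a j) = 0
        rw [Fintype.linearCombination_apply]
        exact h1 j
      exact hle hs')
    have h2 : ∀ i, e i = f i • g 1 := by
      intro i
      have := hg (Pi.single i 1)
      rw [Fintype.linearCombination_apply_single, Fintype.linearCombination_apply_single, one_smul, one_smul] at this
      rw [← this, ← map_smul, smul_eq_mul, mul_one]
    rw [hχ]
    have h3 := congrArg (fun t : CharacterModule A => t (g 1)) hx
    change (∑ i, f i • x i : A →+ AddCircle (1 : ℚ)) (g 1) = 0 at h3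
    erw [AddMonoidHom.finsetSum_apply] at h3
    rw [← h3]
    refine Finset.sum_congr rfl fun i _ => ?_
    rw [h2 i]; rfl)
  let y : Fin k → CharacterModule A := fun j => ((ψ : (Fin k → A) →+ AddCircle (1 : ℚ)).comp
    (AddMonoidHom.single (fun _ : Fin k => A) j) : A →+ AddCircle (1 : ℚ))
  have hy : ∀ j t, y j t = ψ (Pi.single j t) := fun j t => rfl
  refine ⟨k, fun i j => a j i, y, ?_, haS⟩
  intro i
  apply CharacterModule.ext
  intro t
  have h1 := hψ (Pi.single i t)
  rw [hχ] at h1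
  have h2 : ∑ i', x i' ((Pi.single i t : Fin l → A) i') = x i t := by
    rw [Finset.sum_eq_single i]
    · rw [Pi.single_eq_same]
    · intro b _ hb
      rw [Pi.single_eq_of_ne hb, map_zero]
    · intro h; exact absurd (Finset.mem_univ _) h
  rw [h2] at h1
  have h3 : Φ (Pi.single i t) = ∑ j, Pi.single j (a j i • t) := by
    ext j
    rw [hΦ, Finset.sum_apply, Finset.sum_eq_single i, Finset.sum_eq_single j]
    · simp
    · intro b _ hb
      rw [Pi.single_eq_of_ne hb.symm]
    · intro h; exact absurd (Finset.mem_univ _) h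
    · intro b _ hb
      rw [Pi.single_eq_of_ne hb, smul_zero]
    · intro h; exact absurd (Finset.mem_univ _) h
  rw [← h1, h3, map_sum]
  symm
  change (∑ j, a j i • y j : A →+ AddCircle (1 : ℚ)) t = _
  erw [AddMonoidHom.finsetSum_apply]
  rfl

theorem dual_ev [IsNoetherianRing R] (s : ℕ) : ∀ (H : Type u) [AddCommGroup H] [Module R H],
    (∀ (A : Type u) [AddCommGroup A] [Module R A] (i : ℕ), s < i → EV R i A H) →
    ∀ (C : Type u) [AddCommGroup C] [Module R C] (i : ℕ), s < i →
      EV R i (CharacterModule H) (CharacterModule C) := by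
  induction s with
  | zero =>
    intro H _ _ h C _ _ i hi
    obtain ⟨i, rfl⟩ := Nat.exists_eq_succ_of_ne_zero hi.ne'
    have : Module.Flat R (CharacterModule H) := flat_dual (injective_of_ev fun C _ _ => h C 1 (by omega))
    exact ev_flat i
  | succ s ih =>
    intro H _ _ h C _ _ i hi
    obtain ⟨i, rfl⟩ := Nat.exists_eq_succ_of_ne_zero (show i ≠ 0 by omega)
    obtain ⟨I, f, hI, hf⟩ := exists_inj (R := R) H
    have := flat_dual hI
    refine (ses_quot hf).dual.ev_right (ih _ ?_ C i (by omega)) (ev_flat i)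
    intro A _ _ j hj
    obtain ⟨j, rfl⟩ := Nat.exists_eq_succ_of_ne_zero (show j ≠ 0 by omega)
    exact (ses_quot hf).ev_right' (ev_inj _) (h A _ (by omega))

/-- class used for duals of Gorenstein flat modules -/
def TF (R : Type u) [CommRing R] (D : Type u) [AddCommGroup D] [Module R D] (s : ℕ)
    (G : ModuleCat.{u} R) : Prop :=
  (∀ (I : Type u) [AddCommGroup I] [Module R I], Module.Injective R I → EV R 1 I G) ∧
  EV R (s + 1) D G

theorem good_TF (D : Type u) [AddCommGroup D] [Module R D] (s : ℕ) : Good (TF R D s) where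
  iso _ _ _ _ _ _ e h := ⟨fun I _ _ hI => ev_congr' e.symm (h.1 I hI), ev_congr' e.symm h.2⟩
  ext _ _ _ _ _ _ _ _ _ _ _ hs hA hC :=
    ⟨fun I _ _ hI => hs.ev_mid' (hA.1 I hI) (hC.1 I hI), hs.ev_mid' hA.2 hC.2⟩
  ev _ _ _ h I _ _ hI := h.1 I hI

theorem gorflat_TF (D : Type u) [AddCommGroup D] [Module R D] (s : ℕ)
  (hD : ∀ (C : Type u) [AddCommGroup C] [Module R C], EV R (s + 1) D (CharacterModule C))
  (Z : ℤ → ModuleCat.{u} R) (d : ∀ i : ℤ, Z i →ₗ[R] Z (i + 1))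
  (hZ : ∀ i, Module.Flat R (Z i))
  (hex : ∀ i, Function.Exact (d i) (d (i + 1)))
  (ht : ∀ (I : ModuleCat.{u} R), Module.Injective R I →
      ∀ i : ℤ, Function.Exact (LinearMap.rTensor (R := R) I (d i))
        (LinearMap.rTensor (R := R) I (d (i + 1))))
    (j : ℤ) (N : Type u) [AddCommGroup N] [Module R N] (π : Z (j+1) →ₗ[R] N)
    (hπ : Function.Surjective π) (he : Function.Exact (d j) π) :
    TF R D s (ModuleCat.of R (CharacterModule N)) := by
  refine ⟨?_, hD N⟩
  intro I _ _ hI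
  apply ev_swap
  refine ev_one_of_ext (ses_ker hπ) (ev_flat 0) ?_
  obtain ⟨j, rfl⟩ : ∃ k, j = k + 1 := ⟨j - 1, by ring⟩
  apply rTensor_injective_iff_lcomp_surjective.1
  let q : Z (j+1) →ₗ[R] LinearMap.ker π :=
    LinearMap.codRestrict _ (d (j+1)) (fun x => (he _).2 ⟨x, rfl⟩)
  have hq : Function.Surjective q := by
    rintro ⟨y, hy⟩
    obtain ⟨x, hx⟩ := (he y).1 hy
    exact ⟨x, Subtype.ext hx⟩
  have hq1 : (LinearMap.ker π).subtype ∘ₗ q = d (j+1) := rfl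
  have hq2 : q ∘ₗ d j = 0 := by
    ext x
    apply (hex j _).2
    exact ⟨x, rfl⟩
  rw [injective_iff_map_eq_zero]
  intro w hw
  obtain ⟨w', rfl⟩ := LinearMap.rTensor_surjective I hq w
  have h1 : LinearMap.rTensor I (d (j+1)) w' = 0 := by
    rw [← hq1, LinearMap.rTensor_comp]; exact hw
  obtain ⟨w'', rfl⟩ := (ht (ModuleCat.of R I) hI j w').1 h1
  change LinearMap.rTensor I q (LinearMap.rTensor I (d j) w'') = 0
  rw [← LinearMap.comp_apply, ← LinearMap.rTensor_comp, hq2]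
  simp

theorem gorflat_GI (D : Type u) [AddCommGroup D] [Module R D] (s : ℕ)
  (hD : ∀ (C : Type u) [AddCommGroup C] [Module R C], EV R (s + 1) D (CharacterModule C))
  (Z : ℤ → ModuleCat.{u} R) (d : ∀ i : ℤ, Z i →ₗ[R] Z (i + 1))
  (hZ : ∀ i, Module.Flat R (Z i))
  (hex : ∀ i, Function.Exact (d i) (d (i + 1)))
  (ht : ∀ (I : ModuleCat.{u} R), Module.Injective R I →
      ∀ i : ℤ, Function.Exact (LinearMap.rTensor (R := R) I (d i))
        (LinearMap.rTensor (R := R) I (d (i + 1))))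
    (m : ℕ) : ∀ (j : ℤ) (N : Type u) [AddCommGroup N] [Module R N]
    (π : Z (j+1) →ₗ[R] N) (_ : Function.Surjective π) (_ : Function.Exact (d j) π),
    GI (TF R D s) m (ModuleCat.of R (CharacterModule N)) := by
  induction m with
  | zero => intro j N _ _ π hπ he; exact gorflat_TF D s hD Z d hZ hex ht j N π hπ he
  | succ m ih =>
    intro j N _ _ π hπ he
    refine ⟨gorflat_TF D s hD Z d hZ hex ht j N π hπ he, ?_⟩
    have hle : LinearMap.ker π ≤ LinearMap.ker (d (j+1)) := by
      intro x hx
      exact (hex j x).2 ((he x).1 hx)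
    let e := LinearMap.quotKerEquivOfSurjective π hπ
    let δ : N →ₗ[R] Z (j+1+1) := (LinearMap.ker π).liftQ (d (j+1)) hle ∘ₗ e.symm.toLinearMap
    have hδ : ∀ x, δ (π x) = d (j+1) x := by
      intro x
      have : e.symm (π x) = Submodule.Quotient.mk x := by
        rw [LinearEquiv.symm_apply_eq]; rfl
      change (LinearMap.ker π).liftQ (d (j+1)) hle (e.symm (π x)) = _
      rw [this]; rfl
    have hδi : Function.Injective δ := by
      rw [injective_iff_map_eq_zero]
      intro n hn
      obtain ⟨x, rfl⟩ := hπ n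
      rw [hδ] at hn
      exact (he x).2 ((hex j x).1 hn)
    have hr : LinearMap.range δ = LinearMap.range (d (j+1)) := by
      ext y
      constructor
      · rintro ⟨n, rfl⟩
        obtain ⟨x, rfl⟩ := hπ n
        exact ⟨x, (hδ x).symm⟩
      · rintro ⟨x, rfl⟩
        exact ⟨π x, hδ x⟩
    have hs := (ses_quot hδi).dual
    refine ⟨ModuleCat.of R (CharacterModule (Z (j+1+1))), CharacterModule.dual δ, injective_dual_flat, hs.surj, ?_⟩
    have h1 := ih (j+1) (Z (j+1+1) ⧸ LinearMap.range δ) (LinearMap.range δ).mkQ (Submodule.mkQ_surjective _) (by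
      rw [hr]; exact LinearMap.exact_map_mkQ_range _)
    refine GI_iso (good_TF D s) ?_ h1
    exact (LinearEquiv.ofInjective _ hs.inj).trans (LinearEquiv.ofEq _ _ (LinearMap.exact_iff.1 hs.ex).symm)

theorem coresDimLE_iso (P : ModuleCat.{u} R → Prop) (hP : ∀ (A B : Type u) [AddCommGroup A] [Module R A]
    [AddCommGroup B] [Module R B], (A ≃ₗ[R] B) → P (ModuleCat.of R A) → P (ModuleCat.of R B)) (k : ℕ) :
    ∀ (A B : Type u) [AddCommGroup A] [Module R A]
    [AddCommGroup B] [Module R B], (A ≃ₗ[R] B) → CoresDimLE R P k (ModuleCat.of R A) →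
      CoresDimLE R P k (ModuleCat.of R B) := by
  induction k with
  | zero => exact hP
  | succ k ih =>
    rintro A B _ _ _ _ e (h | ⟨X, f, hX, hf, hk⟩)
    · exact Or.inl (ih A B e h)
    · refine Or.inr ⟨X, f ∘ₗ e.symm.toLinearMap, hX, hf.comp e.symm.injective, ?_⟩
      have : LinearMap.range (f ∘ₗ e.symm.toLinearMap) = LinearMap.range f := by
        ext y; constructor
        · rintro ⟨b, rfl⟩; exact ⟨e.symm b, rfl⟩
        · rintro ⟨a, rfl⟩; exact ⟨e a, by simp⟩
      rw [this]
      exact hk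

theorem res_to_cores (Q P : ModuleCat.{u} R → Prop) (hP : ∀ (A B : Type u) [AddCommGroup A] [Module R A]
    [AddCommGroup B] [Module R B], (A ≃ₗ[R] B) → P (ModuleCat.of R A) → P (ModuleCat.of R B))
    (hQ : ∀ X : ModuleCat.{u} R, Q X → P (ModuleCat.of R (CharacterModule X))) (k : ℕ) :
    ∀ (N : ModuleCat.{u} R), ResDimLE R Q k N →
      CoresDimLE R P k (ModuleCat.of R (CharacterModule N)) := by
  induction k with
  | zero => exact hQ
  | succ k ih =>
    rintro N (h | ⟨X, f, hX, hf, hk⟩)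
    · exact Or.inl (ih N h)
    · have hs := (ses_ker hf).dual
      refine Or.inr ⟨ModuleCat.of R (CharacterModule X), CharacterModule.dual f, hQ X hX, hs.inj, ?_⟩
      refine coresDimLE_iso P hP k _ _ ?_ (ih _ hk)
      exact ((Submodule.quotEquivOfEq _ _ (LinearMap.exact_iff.1 hs.ex).symm).trans
        (LinearMap.quotKerEquivOfSurjective _ hs.surj)).symm

theorem GflatDim_lemma [IsNoetherianRing R] (H : ModuleCat.{u} R) (h : GflatDim R H ≠ ⊤) (s : ℕ)
    (hs : ∀ (A : Type u) [AddCommGroup A] [Module R A] (i : ℕ), s < i → EV R i A H) :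
    ∃ b : ℕ, ∀ (C : Type u) [AddCommGroup C] [Module R C] (i : ℕ), b < i →
      EV R i H (CharacterModule C) := by
  obtain ⟨d, hd⟩ := (sInf_ne_top_iff _).1 h
  have hD := dual_ev s H hs
  have hT := good_TF (R := R) (CharacterModule H) s
  have h1 := res_to_cores (fun N => IsGorensteinFlat R N)
    (fun X => ∀ m, GI (TF R (CharacterModule H) s) m X)
    (fun A B _ _ _ _ e hA m => GI_iso hT e (hA m)) (by
      rintro X ⟨Z, d, hZ, hex, ht, π, hπ, he⟩ m
      have h0 : (0 : ℤ) = -1 + 1 := rfl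
      have key : ∃ π : Z (-1 + 1) →ₗ[R] X, Function.Surjective π ∧ Function.Exact (d (-1)) π :=
        ⟨π, hπ, he⟩
      obtain ⟨π, hπ, he⟩ := key
      exact gorflat_GI (CharacterModule H) s (fun C _ _ => hD C _ (by omega)) Z d hZ hex ht m (-1) X π hπ he) d H hd
  obtain ⟨b, hb⟩ := lemmaL hT _ (fun X hX => hX) d _ h1 s (fun K hK => hK.2)
  exact ⟨b, fun C _ _ i hi => ev_swap i _ _ (hb C i hi)⟩

end S3
end Pf

namespace Pf
open Paper
open CategoryTheory.Abelian

section S5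
variable {R : Type u} [CommRing R]

theorem fac_exact (J : Ideal R) (a : R) {T : Type u} [AddCommGroup T] [Module R T] (f : T →ₗ[R] R ⧸ J)
    (hf : LinearMap.range f = LinearMap.range (a • J.mkQ : R →ₗ[R] R ⧸ J)) :
    Function.Exact f (Submodule.factor (le_sup_left : J ≤ J ⊔ Ideal.span {a})) := by
  intro y
  have : y ∈ Set.range f ↔ y ∈ LinearMap.range f := by simp
  rw [this, hf]
  obtain ⟨y, rfl⟩ := J.mkQ_surjective y
  have h1 : (Submodule.factor (le_sup_left : J ≤ J ⊔ Ideal.span {a})) (J.mkQ y) =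
      (J ⊔ Ideal.span {a}).mkQ y := rfl
  rw [h1, Submodule.mkQ_apply, Submodule.Quotient.mk_eq_zero]
  constructor
  · intro h
    obtain ⟨j, hj, b, hb, rfl⟩ := Submodule.mem_sup.1 h
    obtain ⟨c, rfl⟩ := Ideal.mem_span_singleton'.1 hb
    refine ⟨c, ?_⟩
    simp only [LinearMap.smul_apply, map_add]
    rw [(Submodule.Quotient.mk_eq_zero J).2 hj |> (fun h => (h : J.mkQ j = 0)), zero_add, ← map_smul]
    simp [mul_comm]
  · rintro ⟨c, hc⟩
    have : a * c - y ∈ J := by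
      rw [← Submodule.Quotient.mk_eq_zero J, Submodule.Quotient.mk_sub, sub_eq_zero]
      exact hc
    have h2 : y = a * c - (a * c - y) := by ring
    rw [h2]
    exact Submodule.sub_mem _ (Submodule.mem_sup_right (Ideal.mem_span_singleton'.2 ⟨c, mul_comm _ _⟩))
      (Submodule.mem_sup_left this)

theorem fac_surj {J K : Ideal R} (h : J ≤ K) : Function.Surjective (Submodule.factor h) := by
  intro y
  obtain ⟨y, rfl⟩ := K.mkQ_surjective y
  exact ⟨J.mkQ y, rfl⟩

theorem bass_cyclic [IsNoetherianRing R] [IsLocalRing R] (M : Type u) [AddCommGroup M] [Module R M]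
    [Module.Finite R M] (s : ℕ) (hk : ∀ i, s < i → EV R i (R ⧸ maximalIdeal R) M) (J : Ideal R) :
    ∀ i, s < i → EV R i (R ⧸ J) M := by
  induction J using IsNoetherian.induction with
  | hgt J ih =>
  intro i hi
  by_cases hT : J = ⊤
  · subst hT
    have : Subsingleton (R ⧸ (⊤ : Ideal R)) := Ideal.Quotient.subsingleton_iff.2 rfl
    obtain ⟨i, rfl⟩ := Nat.exists_eq_succ_of_ne_zero (by omega : i ≠ 0)
    exact ev_proj i
  by_cases hP : Ideal.IsPrime J
  · by_cases hm : J = maximalIdeal R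
    · subst hm; exact hk i hi
    obtain ⟨x, hxm, hxJ⟩ : ∃ x ∈ maximalIdeal R, x ∉ J := by
      by_contra! hc
      exact hm (le_antisymm (le_maximalIdeal hT) hc)
    have hs : SES (x • LinearMap.id : (R ⧸ J) →ₗ[R] R ⧸ J)
        (Submodule.factor (le_sup_left : J ≤ J ⊔ Ideal.span {x})) := by
      refine ⟨?_, fac_exact J x _ ?_, fac_surj _⟩
      · rw [← LinearMap.ker_eq_bot, LinearMap.ker_eq_bot']
        intro y hy
        obtain ⟨y, rfl⟩ := J.mkQ_surjective y
        have : x * y ∈ J := (Submodule.Quotient.mk_eq_zero J).1 hy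
        exact (Submodule.Quotient.mk_eq_zero J).2 ((hP.mem_or_mem this).resolve_left hxJ)
      · ext y
        constructor
        · rintro ⟨z, rfl⟩
          obtain ⟨z, rfl⟩ := J.mkQ_surjective z
          exact ⟨z, rfl⟩
        · rintro ⟨z, rfl⟩
          exact ⟨J.mkQ z, rfl⟩
    have hlt : J < J ⊔ Ideal.span {x} := by
      refine lt_of_le_of_ne le_sup_left fun h => hxJ ?_
      rw [h]
      exact Submodule.mem_sup_right (Ideal.mem_span_singleton_self x)
    have h1 := ih _ hlt (i+1) (by omega)
    have hfin : Module.Finite R (Ext.{u} (ModuleCat.of R (R ⧸ J)) (ModuleCat.of R M) i) := by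
      have : Module.Finite R (ModuleCat.of R (R ⧸ J)) := inferInstanceAs (Module.Finite R (R ⧸ J))
      have : Module.Finite R (ModuleCat.of R M) := inferInstanceAs (Module.Finite R M)
      exact ModuleCat.finite_ext _ _ _ _
    have hsurj : ∀ e : Ext.{u} (ModuleCat.of R (R ⧸ J)) (ModuleCat.of R M) i, ∃ e', x • e' = e := by
      intro e
      obtain ⟨y, hy⟩ := Ext.contravariant_sequence_exact₁ hs.se (ModuleCat.of R M) e (add_comm 1 i) (h1 _)
      refine ⟨y, ?_⟩
      rw [← hy]
      have h2 : hs.sc.f = x • 𝟙 (ModuleCat.of R (R ⧸ J)) := rfl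
      have h3 : Ext.mk₀ hs.sc.f = x • Ext.mk₀ (𝟙 (ModuleCat.of R (R ⧸ J))) := by
        rw [h2, Ext.mk₀_smul]
      have h4 := congrArg (fun t : Ext.{u} (ModuleCat.of R (R ⧸ J)) (ModuleCat.of R (R ⧸ J)) 0 => t.comp y (zero_add i)) h3
      refine Eq.trans ?_ h4.symm
      show _ = (x • Ext.mk₀ (𝟙 (ModuleCat.of R (R ⧸ J)))).comp y (zero_add i)
      rw [Ext.smul_comp, Ext.mk₀_id_comp]
    have htop : (⊤ : Submodule R (Ext.{u} (ModuleCat.of R (R ⧸ J)) (ModuleCat.of R M) i)) = ⊥ := by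
      refine Submodule.eq_bot_of_le_smul_of_le_jacobson_bot (maximalIdeal R) _ hfin.fg_top ?_ ?_
      · intro e _
        obtain ⟨e', rfl⟩ := hsurj e
        exact Submodule.smul_mem_smul hxm trivial
      · exact IsLocalRing.maximalIdeal_le_jacobson _
    intro e
    have : e ∈ (⊤ : Submodule R (Ext.{u} (ModuleCat.of R (R ⧸ J)) (ModuleCat.of R M) i)) := trivial
    rw [htop] at this
    exact this
  · rw [Ideal.isPrime_iff] at hP
    push Not at hP
    obtain ⟨a, b, hab, ha, hb⟩ := hP hT
    set φ : R →ₗ[R] R ⧸ J := a • J.mkQ with hφ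
    have hs : SES ((LinearMap.ker φ).liftQ φ le_rfl)
        (Submodule.factor (le_sup_left : J ≤ J ⊔ Ideal.span {a})) := by
      refine ⟨?_, fac_exact J a _ ?_, fac_surj _⟩
      · rw [← LinearMap.ker_eq_bot]
        exact Submodule.ker_liftQ_eq_bot' _ _ rfl
      · rw [Submodule.range_liftQ]
    have hmem : ∀ c, c ∈ LinearMap.ker φ ↔ a * c ∈ J := by
      intro c
      exact Submodule.Quotient.mk_eq_zero J
    refine hs.ev_mid (ih _ ?_ i hi) (ih (LinearMap.ker φ) ?_ i hi)
    · refine lt_of_le_of_ne le_sup_left fun h => ha ?_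
      rw [h]
      exact Submodule.mem_sup_right (Ideal.mem_span_singleton_self a)
    · refine lt_of_le_of_ne (fun c hc => (hmem c).2 (Ideal.mul_mem_left J _ hc)) fun h => hb ?_
      rw [h]
      exact (hmem b).2 hab

theorem cores_of_cyclic (s : ℕ) : ∀ (N : ModuleCat.{u} R),
    (∀ (J : Ideal R) i, s < i → EV R i (R ⧸ J) N) → CoresDimLE R (fun N => Module.Injective R N) s N := by
  induction s with
  | zero =>
    intro N h
    refine Module.Baer.injective fun J g => ?_
    obtain ⟨ψ, hψ⟩ := ev_one_ext (ses_sub (J : Submodule R R)) (h J 1 (by omega)) g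
    refine ⟨ψ, fun x hx => ?_⟩
    rw [← hψ]; rfl
  | succ s ih =>
    intro N h
    obtain ⟨I, f, hI, hf⟩ := exists_inj (R := R) N
    refine Or.inr ⟨I, f, hI, hf, ih _ fun J i hi => ?_⟩
    obtain ⟨i, rfl⟩ := Nat.exists_eq_succ_of_ne_zero (by omega : i ≠ 0)
    exact (ses_quot hf).ev_right' (ev_inj i) (h J _ (by omega))

theorem bass [IsNoetherianRing R] [IsLocalRing R] (M : Type u) [AddCommGroup M] [Module R M]
    [Module.Finite R M] (s : ℕ) (hk : ∀ i, s < i → EV R i (R ⧸ maximalIdeal R) M) : injDim R M ≠ ⊤ := by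
  have := cores_of_cyclic s (ModuleCat.of R M) (fun J i hi => bass_cyclic M s hk J i hi)
  exact (sInf_ne_top_iff _).2 ⟨s, this⟩

theorem res_of_char [IsNoetherianRing R] [IsLocalRing R] (s : ℕ) : ∀ (M : ModuleCat.{u} R) [Module.Finite R M],
    (∀ i, s < i → EV R i M (CharacterModule (R ⧸ maximalIdeal R))) →
      ResDimLE R (fun N => Module.Projective R N) s M := by
  induction s with
  | zero =>
    intro M _ h
    obtain ⟨n, f, hf⟩ := Module.Finite.exists_fin' R M
    have hs := ses_ker hf
    have h1 : Function.Surjective ((LinearMap.ker f).subtype.lcomp R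
        (CharacterModule (R ⧸ maximalIdeal R))) := by
      intro φ
      exact ev_one_ext hs (h 1 (by omega)) φ
    have h2 := rTensor_injective_iff_lcomp_surjective.2 h1
    have h3 : Function.Injective ((LinearMap.ker f).subtype.lTensor (ResidueField R)) :=
      (LinearMap.lTensor_inj_iff_rTensor_inj _ _).2 h2
    have h4 := Module.free_of_lTensor_residueField_injective (LinearMap.ker f).subtype f hf hs.ex h3
    exact Module.Projective.of_free
  | succ s ih =>
    intro M _ h
    obtain ⟨n, f, hf⟩ := Module.Finite.exists_fin' R M
    have hs := ses_ker hf
    have : Module.Finite R (ModuleCat.of R (LinearMap.ker f)) :=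
      inferInstanceAs (Module.Finite R (LinearMap.ker f))
    refine Or.inr ⟨ModuleCat.of R (Fin n → R), f, ?_, hf, ih _ fun i hi => ?_⟩
    · exact inferInstanceAs (Module.Projective R (Fin n → R))
    · obtain ⟨i, rfl⟩ := Nat.exists_eq_succ_of_ne_zero (by omega : i ≠ 0)
      exact hs.ev_left (ev_proj i) (h _ (by omega))

theorem pd_of_char [IsNoetherianRing R] [IsLocalRing R] (M : Type u) [AddCommGroup M] [Module R M]
    [Module.Finite R M] (s : ℕ)
    (hk : ∀ i, s < i → EV R i M (CharacterModule (R ⧸ maximalIdeal R))) : projDim R M ≠ ⊤ := by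
  have : Module.Finite R (ModuleCat.of R M) := inferInstanceAs (Module.Finite R M)
  exact (sInf_ne_top_iff _).2 ⟨s, res_of_char s (ModuleCat.of R M) hk⟩

end S5
end Pf

namespace Pf
open Paper
open CategoryTheory.Abelian

section S6
variable {R : Type u} [CommRing R]

/-- elements torsion with respect to all members of a list -/
def tors (L : List R) (X : Type u) [AddCommGroup X] [Module R X] : Submodule R X where
  carrier := {z | ∀ x ∈ L, ∃ t : ℕ, x ^ t • z = 0}
  zero_mem' := fun x _ => ⟨0, by simp⟩
  add_mem' := by
    intro a b ha hb x hx
    obtain ⟨t, ht⟩ := ha x hx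
    obtain ⟨s, hs⟩ := hb x hx
    refine ⟨s + t, ?_⟩
    rw [smul_add, pow_add, mul_smul, ht, mul_comm, mul_smul, hs]; simp
  smul_mem' := by
    intro c a ha x hx
    obtain ⟨t, ht⟩ := ha x hx
    exact ⟨t, by rw [smul_comm, ht, smul_zero]⟩

theorem mem_tors {L : List R} {X : Type u} [AddCommGroup X] [Module R X] {z : X} :
    z ∈ tors L X ↔ ∀ x ∈ L, ∃ t : ℕ, x ^ t • z = 0 := Iff.rfl

theorem tors_map {L : List R} {X Y : Type u} [AddCommGroup X] [Module R X] [AddCommGroup Y]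
    [Module R Y] (f : X →ₗ[R] Y) {z : X} (hz : z ∈ tors L X) : f z ∈ tors L Y := by
  intro x hx
  obtain ⟨t, ht⟩ := hz x hx
  exact ⟨t, by rw [← map_smul, ht, map_zero]⟩

theorem tors_of_map {L : List R} {X Y : Type u} [AddCommGroup X] [Module R X] [AddCommGroup Y]
    [Module R Y] (f : X →ₗ[R] Y) (hf : Function.Injective f) {z : X} (hz : f z ∈ tors L Y) :
    z ∈ tors L X := by
  intro x hx
  obtain ⟨t, ht⟩ := hz x hx
  exact ⟨t, hf (by rw [map_smul, ht, map_zero])⟩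

theorem mem_tors_cons {x : R} {L : List R} {X : Type u} [AddCommGroup X] [Module R X] {z : X} :
    z ∈ tors (x :: L) X ↔ (∃ t : ℕ, x ^ t • z = 0) ∧ z ∈ tors L X := by
  simp [mem_tors]

theorem tors_nil {X : Type u} [AddCommGroup X] [Module R X] : tors ([] : List R) X = ⊤ := by
  ext; simp [mem_tors]

/-- torsion in terms of the ideal -/
theorem mem_tors_iff [IsNoetherianRing R] {L : List R} {X : Type u} [AddCommGroup X] [Module R X]
    {z : X} : z ∈ tors L X ↔ ∃ t : ℕ, ∀ r ∈ (Ideal.span {x | x ∈ L}) ^ t, r • z = 0 := by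
  constructor
  · intro h
    let A : Ideal R := LinearMap.ker (LinearMap.toSpanSingleton R X z)
    have hA : Ideal.span {x | x ∈ L} ≤ A.radical := by
      rw [Ideal.span_le]
      intro x hx
      obtain ⟨t, ht⟩ := h x hx
      exact ⟨t, ht⟩
    obtain ⟨t, ht⟩ := Ideal.exists_pow_le_of_le_radical_of_fg hA (IsNoetherian.noetherian _)
    exact ⟨t, fun r hr => ht hr⟩
  · rintro ⟨t, ht⟩ x hx
    exact ⟨t, ht _ (Ideal.pow_mem_pow (Ideal.subset_span (s := {x | x ∈ L}) hx) _)⟩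

theorem tors_mono_pow {𝔞 : Ideal R} {s t : ℕ} (h : s ≤ t) {X : Type u} [AddCommGroup X] [Module R X]
    {z : X} (hz : ∀ r ∈ 𝔞 ^ s, r • z = 0) : ∀ r ∈ 𝔞 ^ t, r • z = 0 :=
  fun r hr => hz r (Ideal.pow_le_pow_right h hr)

/-- torsion part of an injective module is injective -/
theorem tors_injective [IsNoetherianRing R] (L : List R) (I : Type u) [AddCommGroup I] [Module R I]
    (hI : Module.Injective R I) : Module.Injective R (tors L I) := by
  refine Module.Baer.injective fun J g => ?_
  set 𝔞 := Ideal.span {x | x ∈ L} with h𝔞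
  -- a common power killing the image
  have h1 : ∃ t : ℕ, ∀ j : J, ∀ r ∈ 𝔞 ^ t, r • g j = 0 := by
    have hfg : (⊤ : Submodule R J).FG := IsNoetherian.noetherian _
    obtain ⟨S, hS⟩ := hfg
    choose t ht using fun j : J => mem_tors_iff.1 (g j).2
    refine ⟨S.sup t, fun j r hr => ?_⟩
    have hle : Submodule.span R (S : Set J) ≤ LinearMap.ker (r • g) := by
      rw [Submodule.span_le]
      intro j hj
      have := tors_mono_pow (Finset.le_sup (f := t) hj) (ht j) r hr
      exact Subtype.ext this
    exact hle (hS ▸ trivial)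
  obtain ⟨t, ht⟩ := h1
  obtain ⟨k, hk⟩ := Ideal.exists_pow_inf_eq_pow_smul 𝔞 (J : Submodule R R)
  have hk' := hk (t + k) (by omega)
  have h2 : ∀ j : J, ((𝔞 ^ (t + k)).mkQ ∘ₗ (J : Submodule R R).subtype) j = 0 →
      ((tors L I).subtype ∘ₗ g) j = 0 := by
    intro j hj
    have hj' : (j : R) ∈ 𝔞 ^ (t+k) := (Submodule.Quotient.mk_eq_zero _).1 hj
    have h3 : (j : R) ∈ 𝔞 ^ (t + k) • (⊤ : Submodule R R) ⊓ (J : Submodule R R) :=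
      ⟨by simpa using hj', j.2⟩
    rw [hk'] at h3
    have h4 : (j : R) ∈ 𝔞 ^ t • (J : Submodule R R) := by
      refine Submodule.smul_mono ?_ inf_le_right h3
      simp
    have h5 : j ∈ 𝔞 ^ t • (⊤ : Submodule R J) := by
      have : Submodule.map (J : Submodule R R).subtype (𝔞 ^ t • (⊤ : Submodule R J)) = 𝔞 ^ t • (J : Submodule R R) := by
        rw [Submodule.map_smul'', Submodule.map_subtype_top]
      rw [← this] at h4
      obtain ⟨y, hy, hyj⟩ := h4
      have : y = j := Subtype.ext hyj
      rwa [← this]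
    have h6 : g j = 0 := by
      have : 𝔞 ^ t • (⊤ : Submodule R J) ≤ LinearMap.ker g := by
        rw [Submodule.smul_le]
        intro r hr y _
        simpa using ht y r hr
      exact this h5
    simp [h6]
  obtain ⟨ψ, hψ⟩ := inj_factor hI _ _ h2
  refine ⟨(ψ ∘ₗ (𝔞 ^ (t + k)).mkQ).codRestrict (tors L I) ?_, ?_⟩
  · intro c
    rw [mem_tors_iff]
    refine ⟨t + k, fun r hr => ?_⟩
    rw [← map_smul]
    have : (𝔞 ^ (t+k)).mkQ (r • c) = 0 :=
      (Submodule.Quotient.mk_eq_zero _).2 (Ideal.mul_mem_right _ _ hr)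
    simp only [LinearMap.comp_apply, this, map_zero]
  · intro x hx
    exact Subtype.ext (hψ ⟨x, hx⟩)

/-- the localization map at `x` is surjective -/
def XDiv (x : R) (W : Type u) [AddCommGroup W] [Module R W] : Prop :=
  ∀ (w : W) (t : ℕ), ∃ (w' : W) (c : ℕ), x ^ (c + t) • w' = x ^ c • w

theorem XDiv.of_surj {x : R} {W W' : Type u} [AddCommGroup W] [Module R W] [AddCommGroup W']
    [Module R W'] (h : XDiv x W) (f : W →ₗ[R] W') (hf : Function.Surjective f) : XDiv x W' := by
  intro w t
  obtain ⟨w, rfl⟩ := hf w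
  obtain ⟨w', c, h⟩ := h w t
  exact ⟨f w', c, by rw [← map_smul, h, map_smul]⟩

theorem xdiv_injective [IsNoetherianRing R] (x : R) {I : Type u} [AddCommGroup I] [Module R I]
    (hI : Module.Injective R I) : XDiv x I := by
  intro w t
  have hmono : Monotone (fun c : ℕ => (LinearMap.ker (LinearMap.lsmul R R (x ^ c)) : Ideal R)) := by
    intro a b hab r hr
    obtain ⟨d, rfl⟩ := Nat.exists_eq_add_of_le hab
    have : x ^ a * r = 0 := hr
    show x ^ (a + d) * r = 0
    rw [pow_add, mul_comm (x ^ a), mul_assoc, this, mul_zero]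
  obtain ⟨c, hc⟩ := monotone_stabilizes_iff_noetherian.2 (inferInstanceAs (IsNoetherian R R))
    ⟨_, hmono⟩
  have hc' := hc (c + t) (by omega)
  obtain ⟨ψ, hψ⟩ := inj_factor hI (LinearMap.lsmul R R (x ^ (c + t)))
    (LinearMap.toSpanSingleton R I (x ^ c • w)) (by
      intro r hr
      have : r ∈ LinearMap.ker (LinearMap.lsmul R R (x ^ (c + t))) := hr
      have h2 : r ∈ LinearMap.ker (LinearMap.lsmul R R (x ^ c)) := by
        have : (LinearMap.ker (LinearMap.lsmul R R (x ^ c)) : Ideal R) = LinearMap.ker (LinearMap.lsmul R R (x ^ (c + t))) := hc'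
        rw [this]; exact hr
      have h3 : x ^ c * r = 0 := h2
      rw [mul_comm] at h3
      simp [smul_smul, h3])
  refine ⟨ψ 1, c, ?_⟩
  have := hψ 1
  simp only [LinearMap.lsmul_apply, map_smul, LinearMap.toSpanSingleton_apply_one] at this
  exact this

section tele
variable {x : R} {A W T : Type u} [AddCommGroup A] [Module R A] [AddCommGroup W]
  [Module R W] [AddCommGroup T] [Module R T] {f : A →ₗ[R] W} {g : W →ₗ[R] T}

theorem tele_bij (h : SES f g) (hf : ∀ w, w ∈ LinearMap.range f ↔ ∃ t : ℕ, x ^ t • w = 0)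
    (hd : XDiv x W) : Function.Bijective (LinearMap.lsmul R T x) := by
  constructor
  · rw [← LinearMap.ker_eq_bot, LinearMap.ker_eq_bot']
    intro y hy
    obtain ⟨w, rfl⟩ := h.surj y
    have h1 : g (x • w) = 0 := by rw [map_smul]; exact hy
    obtain ⟨t, ht⟩ := (hf (x • w)).1 ((h.ex _).1 h1)
    exact (h.ex w).2 ((hf w).2 ⟨t + 1, by rw [pow_succ, mul_smul, ht]⟩)
  · intro y
    obtain ⟨w, rfl⟩ := h.surj y
    obtain ⟨w', c, hw⟩ := hd w 1
    refine ⟨g w', ?_⟩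
    have : g (x • w' - w) = 0 := (h.ex _).2 ((hf _).2 ⟨c, by
      rw [smul_sub, smul_smul, ← pow_succ, hw, sub_self]⟩)
    rw [map_sub, sub_eq_zero, map_smul] at this
    exact this

theorem tele_ev_zero {V : Type u} [AddCommGroup V] [Module R V] (hV : ∀ v : V, x • v = 0)
    (hb : Function.Bijective (LinearMap.lsmul R T x)) (i : ℕ) : EV R i T V := by
  intro e
  let u : T ≃ₗ[R] T := LinearEquiv.ofBijective _ hb
  have h1 : (x • 𝟙 (ModuleCat.of R V) : ModuleCat.of R V ⟶ ModuleCat.of R V) = 0 := by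
    ext v; exact hV v
  have h2 : ∀ e : Ext.{u} (ModuleCat.of R T) (ModuleCat.of R V) i, x • e = 0 := by
    intro e
    have : x • e = e.comp (Ext.mk₀ (x • 𝟙 (ModuleCat.of R V))) (add_zero i) := by
      rw [Ext.mk₀_smul, Ext.comp_smul, Ext.comp_mk₀_id]
    rw [this, h1]; simp
  have h3 : ModuleCat.ofHom u.symm.toLinearMap ≫ (x • 𝟙 (ModuleCat.of R T)) = 𝟙 _ := by
    ext v
    exact u.apply_symm_apply v
  have h4 : e = (Ext.mk₀ (ModuleCat.ofHom u.symm.toLinearMap ≫ (x • 𝟙 (ModuleCat.of R T)))).comp e (zero_add i) := by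
    rw [h3, Ext.mk₀_id_comp]
  rw [h4, Linear.comp_smul, Ext.mk₀_smul, Ext.smul_comp]
  exact h2 _

theorem tele_ev (h : SES f g) (hf : ∀ w, w ∈ LinearMap.range f ↔ ∃ t : ℕ, x ^ t • w = 0)
    (hd : XDiv x W) {K : Type u} [AddCommGroup K] [Module R K] {s : ℕ}
    (hW : ∀ i, s < i → EV R i W K) : ∀ i, s < i → EV R i A K := by
  let e : T ≃ₗ[R] T := LinearEquiv.ofBijective _ (tele_bij h hf hd)
  let v : T →ₗ[R] T := e.symm.toLinearMap
  have hxv : ∀ y, x • v y = y := fun y => e.apply_symm_apply y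
  have hvx : ∀ y, v (x • y) = y := fun y => e.symm_apply_apply y
  let Φ : (ℕ →₀ W) →ₗ[R] (ℕ →₀ W) := LinearMap.id - x • Finsupp.lmapDomain W R Nat.succ
  let Θ : (ℕ →₀ W) →ₗ[R] T := Finsupp.lsum R (fun n => (v ^ n) ∘ₗ g)
  have hΦs : ∀ n w, Φ (Finsupp.single n w) = Finsupp.single n w - Finsupp.single (n+1) (x • w) := by
    intro n w
    simp [Φ]
  have hΘs : ∀ n w, Θ (Finsupp.single n w) = (v ^ n) (g w) := by
    intro n w
    simp [Θ]
  have hΘΦ : ∀ y, Θ (Φ y) = 0 := by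
    intro y
    have : Θ ∘ₗ Φ = 0 := by
      refine Finsupp.lhom_ext fun n w => ?_
      rw [LinearMap.comp_apply, hΦs, map_sub, hΘs, hΘs, pow_succ, Module.End.mul_apply, map_smul, hvx]
      simp
    exact LinearMap.congr_fun this y
  have hstep : ∀ n w c, Finsupp.single n w - Finsupp.single (n + c) (x ^ c • w) ∈ LinearMap.range Φ := by
    intro n w c
    induction c with
    | zero => simp
    | succ c ih =>
      have := Submodule.add_mem _ ih ⟨Finsupp.single (n + c) (x ^ c • w), rfl⟩
      rw [hΦs, smul_smul, ← pow_succ'] at this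
      simpa [add_assoc] using this
  have hred : ∀ y : ℕ →₀ W, ∃ N w, ∀ c, y - Finsupp.single (N + c) (x ^ c • w) ∈ LinearMap.range Φ := by
    intro y
    induction y using Finsupp.induction_linear with
    | zero => exact ⟨0, 0, fun c => by simp⟩
    | add y₁ y₂ h₁ h₂ =>
      obtain ⟨N₁, w₁, h₁⟩ := h₁
      obtain ⟨N₂, w₂, h₂⟩ := h₂
      refine ⟨N₁ + N₂, x ^ N₂ • w₁ + x ^ N₁ • w₂, fun c => ?_⟩
      have := Submodule.add_mem _ (h₁ (N₂ + c)) (h₂ (N₁ + c))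
      convert this using 1
      have e1 : N₁ + (N₂ + c) = N₁ + N₂ + c := by ring
      have e2 : N₂ + (N₁ + c) = N₁ + N₂ + c := by ring
      rw [e1, e2, smul_add, Finsupp.single_add, smul_smul, smul_smul, ← pow_add, ← pow_add,
        add_comm c N₂, add_comm c N₁]
      abel
    | single n w => exact ⟨n, w, hstep n w⟩
  have hvinj : ∀ n y, (v ^ n) y = 0 → y = 0 := by
    intro n
    induction n with
    | zero => intro y hy; simpa using hy
    | succ n ih =>
      intro y hy
      rw [pow_succ, Module.End.mul_apply] at hy
      have := ih _ hy
      rw [← hxv y, this, smul_zero]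
  have hS : SES Φ Θ := by
    refine ⟨?_, ?_, ?_⟩
    · rw [← LinearMap.ker_eq_bot, LinearMap.ker_eq_bot']
      intro y hy
      have h0 : y 0 = 0 := by
        have := DFunLike.congr_fun hy 0
        simp only [Φ, LinearMap.sub_apply, LinearMap.smul_apply, LinearMap.id_apply, Finsupp.lmapDomain_apply,
          Finsupp.sub_apply, Finsupp.smul_apply, Finsupp.zero_apply] at this
        rw [Finsupp.mapDomain_of_notMem_range _ _ (by simp)] at this
        simpa using this
      ext n
      induction n with
      | zero => simpa using h0
      | succ n ih =>
        have := DFunLike.congr_fun hy (n+1)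
        simp only [Φ, LinearMap.sub_apply, LinearMap.smul_apply, LinearMap.id_apply, Finsupp.lmapDomain_apply,
          Finsupp.sub_apply, Finsupp.smul_apply, Finsupp.zero_apply] at this
        rw [show n + 1 = Nat.succ n from rfl, Finsupp.mapDomain_apply Nat.succ_injective, ih] at this
        simpa using this
    · intro y
      constructor
      · intro hy
        obtain ⟨N, w, hN⟩ := hred y
        have h1 : g w = 0 := by
          obtain ⟨y', hy'⟩ := hN 0
          have := hΘΦ y'
          rw [hy', map_sub, hy, hΘs] at this
          apply hvinj (N + 0)
          simpa using this
        obtain ⟨c, hc⟩ := (hf w).1 ((h.ex w).1 h1)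
        have := hN c
        rw [hc] at this
        simpa using this
      · rintro ⟨y', rfl⟩
        exact hΘΦ y'
    · intro y
      obtain ⟨w, rfl⟩ := h.surj y
      exact ⟨Finsupp.single 0 w, by rw [hΘs]; simp⟩
  intro i hi
  refine h.ev_left (hW i hi) (hS.ev_right (ev_finsupp K i W (hW i hi)) (ev_finsupp K (i+1) W (hW _ (by omega))))

end tele

theorem tors_incl {L : List R} {x : R} {X : Type u} [AddCommGroup X] [Module R X] :
    tors (x :: L) X ≤ tors L X := fun _ hz => (mem_tors_cons.1 hz).2

theorem tors_incl_range {L : List R} {x : R} {X : Type u} [AddCommGroup X] [Module R X] (w : tors L X) :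
    w ∈ LinearMap.range (Submodule.inclusion (tors_incl : tors (x :: L) X ≤ tors L X)) ↔
      ∃ t : ℕ, x ^ t • w = 0 := by
  rw [Submodule.range_inclusion, Submodule.mem_comap, Submodule.subtype_apply, mem_tors_cons]
  constructor
  · rintro ⟨⟨t, ht⟩, _⟩
    exact ⟨t, Subtype.ext ht⟩
  · rintro ⟨t, ht⟩
    exact ⟨⟨t, congrArg Subtype.val ht⟩, w.2⟩

theorem ev_tors_cons {L : List R} {x : R} {X : Type u} [AddCommGroup X] [Module R X]
    (hd : XDiv x (tors L X)) {K : Type u} [AddCommGroup K] [Module R K] {s : ℕ}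
    (hW : ∀ i, s < i → EV R i (tors L X) K) : ∀ i, s < i → EV R i (tors (x :: L) X) K :=
  tele_ev (ses_quot (Submodule.inclusion_injective tors_incl)) tors_incl_range hd hW

theorem ses_tower {X : Type u} [AddCommGroup X] [Module R X] {A B : Submodule R X} (h : A ≤ B) :
    SES (Submodule.mapQ (A.comap B.subtype) A B.subtype le_rfl) (Submodule.factor h) := by
  refine ⟨?_, ?_, ?_⟩
  · rw [← LinearMap.ker_eq_bot, LinearMap.ker_eq_bot']
    intro y hy
    obtain ⟨y, rfl⟩ := Submodule.mkQ_surjective _ y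
    exact (Submodule.Quotient.mk_eq_zero _).2 ((Submodule.Quotient.mk_eq_zero A).1 hy)
  · intro y
    obtain ⟨y, rfl⟩ := Submodule.mkQ_surjective _ y
    constructor
    · intro hy
      exact ⟨Submodule.mkQ _ ⟨y, (Submodule.Quotient.mk_eq_zero B).1 hy⟩, rfl⟩
    · rintro ⟨z, hz⟩
      obtain ⟨z, rfl⟩ := Submodule.mkQ_surjective _ z
      rw [← hz]
      exact (Submodule.Quotient.mk_eq_zero B).2 z.2
  · intro y
    obtain ⟨y, rfl⟩ := Submodule.mkQ_surjective _ y
    exact ⟨A.mkQ y, rfl⟩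

theorem ev_quot_tors_cons {L : List R} {x : R} {X : Type u} [AddCommGroup X] [Module R X]
    (hd : XDiv x (tors L X)) {V : Type u} [AddCommGroup V] [Module R V] (hV : ∀ v : V, x • v = 0)
    (hW : ∀ i, EV R i (X ⧸ tors L X) V) (i : ℕ) : EV R i (X ⧸ tors (x :: L) X) V := by
  refine (ses_tower (tors_incl : tors (x :: L) X ≤ tors L X)).ev_mid (hW i) ?_
  have h1 := tele_bij (ses_quot (Submodule.inclusion_injective tors_incl)) tors_incl_range hd
  have h2 := tele_ev_zero hV h1 i
  rw [Submodule.range_inclusion] at h2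
  exact h2

end S6
end Pf

namespace Pf
open Paper
open CategoryTheory.Abelian

section S7
variable {R : Type u} [CommRing R]

/-- An injective coresolution cut into short exact sequences. -/
structure Chain (R : Type u) [CommRing R] where
  /-- cosyzygies -/
  Z : ℕ → ModuleCat.{u} R
  /-- injective modules -/
  I : ℕ → ModuleCat.{u} R
  /-- the inclusion -/
  f : ∀ j, Z j →ₗ[R] I j
  /-- the projection -/
  g : ∀ j, I j →ₗ[R] Z (j + 1)
  ses : ∀ j, SES (f j) (g j)
  inj : ∀ j, Module.Injective R (I j)

theorem exists_chain (M : ModuleCat.{u} R) : ∃ C : Chain R, C.Z 0 = M := by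
  choose E e hE he using fun A : ModuleCat.{u} R => exists_inj (R := R) A
  let G : ∀ A : ModuleCat.{u} R, E A →ₗ[R] (E A ⧸ LinearMap.range (e A)) := fun A => (LinearMap.range (e A)).mkQ
  have hG : ∀ A : ModuleCat.{u} R, SES (e A) (G A) := fun A => ses_quot (he A)
  let Z : ℕ → ModuleCat.{u} R := fun n => Nat.rec M (fun _ A => ModuleCat.of R (E A ⧸ LinearMap.range (e A))) n
  exact ⟨{
    Z := Z
    I := fun j => E (Z j)
    f := fun j => e (Z j)
    g := fun j => G (Z j)
    ses := fun j => hG (Z j)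
    inj := fun j => hE (Z j) }, rfl⟩

theorem ev_subsingleton {A B : Type u} [AddCommGroup A] [Module R A] [AddCommGroup B] [Module R B]
    [Subsingleton A] (i : ℕ) : EV R i A B := by
  cases i with
  | zero => exact ev_zero_iff.2 fun f => LinearMap.ext fun y => by rw [Subsingleton.elim y 0]; simp
  | succ i => exact ev_proj i

variable (C : Chain R)

/-- boundaries of torsion -/
def Bs (L : List R) : ∀ j, Submodule R (C.Z j)
  | 0 => ⊥
  | j + 1 => (tors L (C.I j)).map (C.g j)

theorem Bs_le (L : List R) (j : ℕ) : Bs C L j ≤ tors L (C.Z j) := by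
  cases j with
  | zero => exact bot_le
  | succ j =>
    rintro _ ⟨w, hw, rfl⟩
    exact tors_map _ hw

/-- the candidate for local cohomology -/
abbrev Hc (L : List R) (j : ℕ) : Type u := tors L (C.Z j) ⧸ (Bs C L j).comap (tors L (C.Z j)).subtype

/-- 0 → ΓZ_j → ΓI_j → B_{j+1} → 0 -/
theorem ses_gamma (L : List R) (j : ℕ) :
    SES ((C.f j).restrict (fun _ hw => tors_map (L := L) (C.f j) hw) : tors L (C.Z j) →ₗ[R] tors L (C.I j))
      ((C.g j).restrict (fun _ hw => ⟨_, hw, rfl⟩) : tors L (C.I j) →ₗ[R] Bs C L (j+1)) := by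
  refine ⟨?_, ?_, ?_⟩
  · intro a b h
    exact Subtype.ext ((C.ses j).inj (congrArg Subtype.val h))
  · rintro ⟨w, hw⟩
    constructor
    · intro h
      obtain ⟨y, rfl⟩ := ((C.ses j).ex w).1 (congrArg Subtype.val h)
      exact ⟨⟨y, tors_of_map _ (C.ses j).inj hw⟩, rfl⟩
    · rintro ⟨y, hy⟩
      have : w = C.f j y := (congrArg Subtype.val hy).symm
      subst this
      exact Subtype.ext ((C.ses j).zero _)
  · rintro ⟨_, w, hw, rfl⟩
    exact ⟨⟨w, hw⟩, rfl⟩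

/-- 0 → Z/ΓZ → I/ΓI → Z'/B' → 0 -/
theorem ses_quotgamma (L : List R) (j : ℕ) :
    SES (Submodule.mapQ (tors L (C.Z j)) (tors L (C.I j)) (C.f j) (fun _ hw => tors_map (C.f j) hw))
      (Submodule.mapQ (tors L (C.I j)) (Bs C L (j+1)) (C.g j) (fun _ hw => ⟨_, hw, rfl⟩)) := by
  refine ⟨?_, ?_, ?_⟩
  · rw [← LinearMap.ker_eq_bot, LinearMap.ker_eq_bot']
    intro y hy
    obtain ⟨y, rfl⟩ := Submodule.mkQ_surjective _ y
    exact (Submodule.Quotient.mk_eq_zero _).2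
      (tors_of_map _ (C.ses j).inj ((Submodule.Quotient.mk_eq_zero _).1 hy))
  · intro y
    obtain ⟨y, rfl⟩ := Submodule.mkQ_surjective _ y
    constructor
    · intro hy
      obtain ⟨w, hw, hwy⟩ := (Submodule.Quotient.mk_eq_zero (Bs C L (j+1))).1 hy
      have h1 : C.g j (y - w) = 0 := by rw [map_sub, hwy, sub_self]
      obtain ⟨z, hz⟩ := ((C.ses j).ex _).1 h1
      refine ⟨Submodule.mkQ _ z, ?_⟩
      have h2 : Submodule.mkQ (tors L (C.I j)) (C.f j z) = Submodule.mkQ (tors L (C.I j)) y := by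
        rw [hz, map_sub, sub_eq_self]
        exact (Submodule.Quotient.mk_eq_zero _).2 hw
      exact h2
    · rintro ⟨z, hz⟩
      obtain ⟨z, rfl⟩ := Submodule.mkQ_surjective _ z
      rw [← hz]
      have h2 : Submodule.mkQ (Bs C L (j+1)) (C.g j (C.f j z)) = 0 := by
        rw [(C.ses j).zero, map_zero]
      exact h2
  · intro y
    obtain ⟨y, rfl⟩ := Submodule.mkQ_surjective _ y
    obtain ⟨w, rfl⟩ := (C.ses j).surj y
    exact ⟨Submodule.mkQ _ w, rfl⟩

/-- 0 → B → ΓZ → H → 0 -/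
theorem ses_H (L : List R) (j : ℕ) :
    SES (Submodule.inclusion (Bs_le C L j)) ((Bs C L j).comap (tors L (C.Z j)).subtype).mkQ := by
  refine ⟨Submodule.inclusion_injective _, ?_, Submodule.mkQ_surjective _⟩
  rw [LinearMap.exact_iff, Submodule.ker_mkQ, Submodule.range_inclusion]

variable [IsNoetherianRing R]

theorem chain_surj (L : List R) : ∀ j, L.length ≤ j → Bs C L (j + 1) = tors L (C.Z (j+1)) := by
  induction L with
  | nil =>
    intro j _
    refine le_antisymm (Bs_le _ _ _) fun z _ => ?_
    obtain ⟨w, rfl⟩ := (C.ses j).surj z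
    exact ⟨w, by rw [tors_nil]; trivial, rfl⟩
  | cons x L ih =>
    intro j hj
    obtain ⟨j, rfl⟩ := Nat.exists_eq_succ_of_ne_zero (by rintro rfl; simp at hj : j ≠ 0)
    have hj' : L.length ≤ j := by simpa using hj
    refine le_antisymm (Bs_le _ _ _) fun z hz => ?_
    obtain ⟨⟨t, ht⟩, hzL⟩ := mem_tors_cons.1 hz
    rw [← ih (j+1) (by omega)] at hzL
    obtain ⟨w, hw, rfl⟩ := hzL
    rw [← map_smul] at ht
    obtain ⟨y, hy⟩ := ((C.ses (j+1)).ex _).1 ht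
    have hyL : y ∈ tors L (C.Z (j+1)) :=
      tors_of_map (C.f (j+1)) (C.ses (j+1)).inj (by rw [hy]; exact Submodule.smul_mem _ _ hw)
    rw [← ih j hj'] at hyL
    obtain ⟨v, hv, rfl⟩ := hyL
    obtain ⟨v', c, hv'⟩ := xdiv_injective x (tors_injective L _ (C.inj j)) ⟨v, hv⟩ t
    have hv'' : x ^ (c + t) • (v' : C.I j) = x ^ c • v := congrArg Subtype.val hv'
    refine ⟨w - C.f (j+1) (C.g j v'), ?_, ?_⟩
    · refine mem_tors_cons.2 ⟨⟨c + t, ?_⟩, ?_⟩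
      · rw [smul_sub, ← map_smul, ← map_smul, hv'', pow_add, mul_smul, ← hy, map_smul, map_smul, sub_self]
      · exact Submodule.sub_mem _ hw (tors_map _ (tors_map _ v'.2))
    · rw [map_sub, (C.ses (j+1)).zero, sub_zero]

theorem xdiv_chain (x : R) (L : List R) (j : ℕ) (hj : L.length + 1 ≤ j) : XDiv x (tors L (C.Z j)) := by
  obtain ⟨j, rfl⟩ := Nat.exists_eq_succ_of_ne_zero (by omega : j ≠ 0)
  have h := chain_surj C L j (by omega)
  refine XDiv.of_surj (xdiv_injective x (tors_injective L _ (C.inj j)))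
    ((C.g j).restrict (fun _ hw => tors_map (C.g j) hw)) ?_
  rintro ⟨z, hz⟩
  have hz' := hz
  rw [← h] at hz'
  obtain ⟨w, hw, rfl⟩ := hz'
  exact ⟨⟨w, hw⟩, rfl⟩

theorem ev_tors_chain (L : List R) (K : Type u) [AddCommGroup K] [Module R K] (j s : ℕ)
    (hj : L.length ≤ j) (h : ∀ i, s < i → EV R i (C.Z j) K) : ∀ i, s < i → EV R i (tors L (C.Z j)) K := by
  induction L with
  | nil =>
    intro i hi
    rw [tors_nil]
    exact ev_congr Submodule.topEquiv (h i hi)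
  | cons x L ih =>
    have hj' : L.length + 1 ≤ j := by simpa using hj
    exact ev_tors_cons (xdiv_chain C x L j hj') (ih (by omega))

theorem ev_quot_chain (L : List R) (V : Type u) [AddCommGroup V] [Module R V] (j : ℕ)
    (hj : L.length ≤ j) (hV : ∀ x ∈ L, ∀ v : V, x • v = 0) : ∀ i, EV R i (C.Z j ⧸ tors L (C.Z j)) V := by
  induction L with
  | nil =>
    intro i
    have : Subsingleton (C.Z j ⧸ tors ([] : List R) (C.Z j)) :=
      Submodule.Quotient.subsingleton_iff.2 tors_nil
    exact ev_subsingleton i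
  | cons x L ih =>
    have hj' : L.length + 1 ≤ j := by simpa using hj
    exact ev_quot_tors_cons (xdiv_chain C x L j hj') (hV x (by simp))
      (ih (by omega) fun y hy => hV y (by simp [hy]))

theorem ev_quot_inj (L : List R) (V : Type u) [AddCommGroup V] [Module R V]
    (I : Type u) [AddCommGroup I] [Module R I] (hI : Module.Injective R I)
    (hV : ∀ x ∈ L, ∀ v : V, x • v = 0) : ∀ i, EV R i (I ⧸ tors L I) V := by
  induction L with
  | nil =>
    intro i
    have : Subsingleton (I ⧸ tors ([] : List R) I) :=
      Submodule.Quotient.subsingleton_iff.2 tors_nil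
    exact ev_subsingleton i
  | cons x L ih =>
    exact ev_quot_tors_cons (xdiv_injective x (tors_injective L _ hI)) (hV x (by simp))
      (ih fun y hy => hV y (by simp [hy]))

section main
variable (L : List R) (n : ℕ)

theorem bs_inj (hB : ∀ j, j ≠ n → Bs C L j = tors L (C.Z j)) :
    ∀ j, j ≤ n → Module.Injective R (Bs C L j) := by
  intro j
  induction j with
  | zero =>
    intro _
    have : Subsingleton (Bs C L 0) := inferInstanceAs (Subsingleton (⊥ : Submodule R (C.Z 0)))
    refine Module.Baer.injective fun J g => ⟨0, fun x hx => Subsingleton.elim _ _⟩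
  | succ j ih =>
    intro hj
    have h1 := ih (by omega)
    rw [hB j (by omega)] at h1
    have h2 := tors_injective L _ (C.inj j)
    exact injective_of_ev fun K _ _ => (ses_gamma C L j).ev_right' (ev_inj 0) (ev_inj 1)

theorem main_f (hB : ∀ j, j ≠ n → Bs C L j = tors L (C.Z j)) (s : ℕ)
    (hs : ∀ (K : Type u) [AddCommGroup K] [Module R K] (i : ℕ), s < i → EV R i K (C.Z 0)) :
    ∃ b, ∀ (K : Type u) [AddCommGroup K] [Module R K] (i : ℕ), b < i → EV R i K (Hc C L n) := by
  have h1 : ∀ j, ∀ (K : Type u) [AddCommGroup K] [Module R K] (i : ℕ), 0 < i → s < i + j →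
      EV R i K (C.Z j) := by
    intro j
    induction j with
    | zero => intro K _ _ i _ hi; exact hs K i hi
    | succ j ih =>
      intro K _ _ i hi0 hi
      obtain ⟨i, rfl⟩ := Nat.exists_eq_succ_of_ne_zero (by omega : i ≠ 0)
      have := C.inj j
      exact (C.ses j).ev_right' (ev_inj i) (ih K _ (by omega) (by omega))
  have h2 : ∀ j, s ≤ j → Module.Injective R (C.Z j) := fun j hj =>
    injective_of_ev fun K _ _ => h1 j K 1 (by omega) (by omega)
  have h3 : ∀ d j, n ≤ j → s + n ≤ j + d → ∀ (K : Type u) [AddCommGroup K] [Module R K] (i : ℕ), d < i →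
      EV R i K (tors L (C.Z j)) := by
    intro d
    induction d with
    | zero =>
      intro j _ hj K _ _ i hi
      obtain ⟨i, rfl⟩ := Nat.exists_eq_succ_of_ne_zero (by omega : i ≠ 0)
      have := tors_injective L _ (h2 j (by omega))
      exact ev_inj i
    | succ d ih =>
      intro j hnj hj K _ _ i hi
      obtain ⟨i, rfl⟩ := Nat.exists_eq_succ_of_ne_zero (by omega : i ≠ 0)
      have := tors_injective L _ (C.inj j)
      have h4 := ih (j+1) (by omega) (by omega) K i (by omega)
      rw [← hB (j+1) (by omega)] at h4
      exact (ses_gamma C L j).ev_left' h4 (ev_inj i)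
  refine ⟨s, fun K _ _ i hi => ?_⟩
  have h5 := bs_inj C L n hB n le_rfl
  exact (ses_H C L n).ev_right' (h3 s n le_rfl (by omega) K i hi) (ev_inj i)

theorem main_c (hB : ∀ j, j ≠ n → Bs C L j = tors L (C.Z j)) (s : ℕ)
    (k : Type u) [AddCommGroup k] [Module R k] (hk : ∀ x ∈ L, ∀ v : k, x • v = 0)
    (hs : ∀ i, s < i → EV R i k (Hc C L n)) : ∀ i, n + s < i → EV R i k (C.Z 0) := by
  have h5 := bs_inj C L n hB n le_rfl
  have h1 : ∀ d i, 0 < i → s < i + d → EV R i k (tors L (C.Z (n + d))) := by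
    intro d
    induction d with
    | zero =>
      intro i hi0 hi
      obtain ⟨i, rfl⟩ := Nat.exists_eq_succ_of_ne_zero (by omega : i ≠ 0)
      exact (ses_H C L n).ev_mid' (ev_inj i) (hs _ hi)
    | succ d ih =>
      intro i hi0 hi
      obtain ⟨i, rfl⟩ := Nat.exists_eq_succ_of_ne_zero (by omega : i ≠ 0)
      have := tors_injective L _ (C.inj (n+d))
      have h4 := (ses_gamma C L (n+d)).ev_right' (X := k) (ev_inj i) (ih _ (by omega) (by omega))
      rw [hB (n+d+1) (by omega)] at h4
      exact h4
  have h2 : ∀ j, n + s ≤ j → EV R 1 k (C.Z j) := by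
    intro j hj
    obtain ⟨d, rfl⟩ := Nat.exists_eq_add_of_le (by omega : n ≤ j)
    have := C.inj (n+d)
    refine ev_one_of_lift (C.ses (n+d)) (ev_inj 0) fun φ => ?_
    have hφ : ∀ v, φ v ∈ Bs C L (n+d+1) := by
      intro v
      rw [hB (n+d+1) (by omega)]
      intro x hx
      exact ⟨1, by rw [pow_one, ← map_smul, hk x hx, map_zero]⟩
    obtain ⟨ψ, hψ⟩ := ev_one_lift (ses_gamma C L (n+d)) (h1 d 1 (by omega) (by omega))
      (φ.codRestrict _ hφ)
    refine ⟨(tors L (C.I (n+d))).subtype ∘ₗ ψ, ?_⟩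
    ext v
    exact congrArg Subtype.val (LinearMap.congr_fun hψ v)
  have h3 : ∀ d j, n + s ≤ j + d → EV R (1 + d) k (C.Z j) := by
    intro d
    induction d with
    | zero => intro j hj; exact h2 j hj
    | succ d ih =>
      intro j hj
      have := C.inj j
      exact (C.ses j).ev_left' (ih (j+1) (by omega)) (ev_inj _)
  intro i hi
  obtain ⟨i, rfl⟩ := Nat.exists_eq_add_of_le (by omega : 1 ≤ i)
  exact h3 i 0 (by omega)

theorem main_d (hB : ∀ j, j ≠ n → Bs C L j = tors L (C.Z j)) (s : ℕ)
    (K : ModuleCat.{u} R) (hK : TI R K)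
    (hs : ∀ i, s < i → EV R i (C.Z 0) K) : ∀ i, s + n + 1 < i → EV R i (Hc C L n) K := by
  have h1 : ∀ j i, s + j < i → EV R i (C.Z j) K := by
    intro j
    induction j with
    | zero => intro i hi; exact hs i (by omega)
    | succ j ih =>
      intro i hi
      obtain ⟨i, rfl⟩ := Nat.exists_eq_succ_of_ne_zero (by omega : i ≠ 0)
      exact (C.ses j).ev_right (ih i (by omega)) (hK _ (C.inj j) i)
  have h2 : ∀ d j, n ≤ j → L.length + n ≤ j + d → ∀ i, s + j < i → EV R i (tors L (C.Z j)) K := by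
    intro d
    induction d with
    | zero => intro j hnj hj; exact ev_tors_chain C L K j (s+j) (by omega) (h1 j)
    | succ d ih =>
      intro j hnj hj i hi
      obtain ⟨i, rfl⟩ := Nat.exists_eq_succ_of_ne_zero (by omega : i ≠ 0)
      have h4 := ih (j+1) (by omega) (by omega) (i+1+1) (by omega)
      rw [← hB (j+1) (by omega)] at h4
      exact (ses_gamma C L j).ev_left (hK _ (tors_injective L _ (C.inj j)) i) h4
  intro i hi
  obtain ⟨i, rfl⟩ := Nat.exists_eq_add_of_le' (by omega : 2 ≤ i)
  exact (ses_H C L n).ev_right (hK _ (bs_inj C L n hB n le_rfl) i)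
    (h2 L.length n le_rfl (by omega) _ (by omega))

theorem main_e (hB : ∀ j, j ≠ n → Bs C L j = tors L (C.Z j)) (s : ℕ)
    (V : Type u) [AddCommGroup V] [Module R V] (hV : ∀ x ∈ L, ∀ v : V, x • v = 0)
    (hs : ∀ i, s < i → EV R i (Hc C L n) V) : ∀ i, s < i → EV R i (C.Z 0) V := by
  have h1 : ∀ d j, n ≤ j → L.length + n ≤ j + d → ∀ i, EV R i (C.Z j ⧸ tors L (C.Z j)) V := by
    intro d
    induction d with
    | zero => intro j hnj hj; exact ev_quot_chain C L V j (by omega) hV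
    | succ d ih =>
      intro j hnj hj i
      have h4 := ih (j+1) (by omega) (by omega) (i+1)
      rw [← hB (j+1) (by omega)] at h4
      exact (ses_quotgamma C L j).ev_left (ev_quot_inj L V _ (C.inj j) hV i) h4
  have h2 : ∀ i, s < i → EV R i (C.Z n ⧸ Bs C L n) V := fun i hi =>
    (ses_tower (Bs_le C L n)).ev_mid (h1 L.length n le_rfl (by omega) i) (hs i hi)
  have h3 : ∀ d j, j + d = n → ∀ i, s < i → EV R i (C.Z j ⧸ Bs C L j) V := by
    intro d
    induction d with
    | zero => intro j hj; obtain rfl : j = n := by omega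
              exact h2
    | succ d ih =>
      intro j hj i hi
      rw [hB j (by omega)]
      exact (ses_quotgamma C L j).ev_left (ev_quot_inj L V _ (C.inj j) hV i) (ih (j+1) (by omega) _ (by omega))
  intro i hi
  have h4 := h3 n 0 (by omega) i hi
  exact ev_congr (Submodule.quotEquivOfEqBot (Bs C L 0) rfl).symm h4

end main

end S7
end Pf

namespace Pf
open Paper
open CategoryTheory.Abelian

section S8
variable {R : Type u} [CommRing R] (C : Chain R)

/-- iterated connecting class -/
noncomputable def eta : ∀ j, Ext.{u} (C.Z j) (C.Z 0) j
  | 0 => Ext.mk₀ (𝟙 _)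
  | j + 1 => ((C.ses j).se.extClass : Ext.{u} (C.Z (j+1)) (C.Z j) 1).comp (eta j) (add_comm 1 j)

theorem ext_inj_zero (A : ModuleCat.{u} R) (j i : ℕ) (x : Ext.{u} A (C.I j) (i+1)) : x = 0 := by
  have := C.inj j
  exact ev_inj (R := R) (A := A) (B := C.I j) i x

theorem eta_surj (A : ModuleCat.{u} R) (j : ℕ) : ∀ (i m : ℕ) (hm : i + j = m) (e : Ext.{u} A (C.Z 0) m),
    ∃ x : Ext.{u} A (C.Z j) i, x.comp (eta C j) hm = e := by
  induction j with
  | zero =>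
    intro i m hm e
    obtain rfl : i = m := by omega
    exact ⟨e, Ext.comp_mk₀_id e⟩
  | succ j ih =>
    intro i m hm e
    obtain ⟨x, hx⟩ := ih (i+1) m (by omega) e
    obtain ⟨y, hy⟩ := Ext.covariant_sequence_exact₁ A (C.ses j).se x (ext_inj_zero C A j i _) rfl
    refine ⟨y, ?_⟩
    rw [← hx, ← hy]
    exact (Ext.comp_assoc y _ (eta C j) rfl (add_comm 1 j) (by omega)).symm

theorem eta_inj (A : ModuleCat.{u} R) (j : ℕ) : ∀ (i m : ℕ) (hm : i + 1 + j = m)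
    (x : Ext.{u} A (C.Z j) (i+1)), x.comp (eta C j) hm = 0 → x = 0 := by
  induction j with
  | zero =>
    intro i m hm x hx
    obtain rfl : i + 1 = m := by omega
    exact (Ext.comp_mk₀_id x).symm.trans hx
  | succ j ih =>
    intro i m hm x hx
    have h1 : (x.comp ((C.ses j).se.extClass : Ext.{u} (C.Z (j+1)) (C.Z j) 1) rfl) = 0 := by
      refine ih (i+1) m (by omega) _ ?_
      rw [← hx]
      exact (Ext.comp_assoc x _ (eta C j) rfl (add_comm 1 j) (by omega))
    obtain ⟨y, hy⟩ := Ext.covariant_sequence_exact₃ A (C.ses j).se x rfl h1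
    have h2 := ext_inj_zero C A j i y
    subst h2
    exact hy.symm.trans (Ext.zero_comp ..)

/-- the map from homomorphisms into a cosyzygy -/
noncomputable def tau (A : ModuleCat.{u} R) (j : ℕ) : (A ⟶ C.Z j) →ₗ[R] Ext.{u} A (C.Z 0) j where
  toFun φ := (Ext.mk₀ φ).comp (eta C j) (zero_add j)
  map_add' φ ψ := by rw [Ext.mk₀_add, Ext.add_comp]
  map_smul' r φ := by rw [Ext.mk₀_smul, Ext.smul_comp]; rfl

theorem tau_surj (A : ModuleCat.{u} R) (j : ℕ) : Function.Surjective (tau C A j) := by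
  intro e
  obtain ⟨x, hx⟩ := eta_surj C A j 0 j (zero_add j) e
  obtain ⟨φ, rfl⟩ := (Ext.mk₀_bijective _ _).2 x
  exact ⟨φ, hx⟩

theorem tau_zero (A : ModuleCat.{u} R) (φ : A ⟶ C.Z 0) : tau C A 0 φ = 0 ↔ φ = 0 := by
  have : tau C A 0 φ = Ext.mk₀ φ := Ext.comp_mk₀_id _
  rw [this, Ext.mk₀_eq_zero_iff]

theorem tau_succ (A : ModuleCat.{u} R) (j : ℕ) (φ : A ⟶ C.Z (j+1)) : tau C A (j+1) φ = 0 ↔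
    ∃ ψ : A ⟶ C.I j, ψ ≫ ModuleCat.ofHom (C.g j) = φ := by
  have h0 : tau C A (j+1) φ = ((Ext.mk₀ φ).comp ((C.ses j).se.extClass : Ext.{u} (C.Z (j+1)) (C.Z j) 1) (zero_add 1)).comp
      (eta C j) (add_comm 1 j) :=
    (Ext.comp_assoc (Ext.mk₀ φ) _ (eta C j) (zero_add 1) (add_comm 1 j) (by omega)).symm
  constructor
  · intro h
    rw [h0] at h
    have h1 := eta_inj C A j 0 (j+1) (by omega) _ h
    obtain ⟨y, hy⟩ := Ext.covariant_sequence_exact₃ A (C.ses j).se (Ext.mk₀ φ) (zero_add 1) h1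
    obtain ⟨ψ, rfl⟩ := (Ext.mk₀_bijective _ _).2 y
    refine ⟨ψ, (Ext.mk₀_bijective _ _).1 ?_⟩
    rw [← hy]
    exact (Ext.mk₀_comp_mk₀ _ _).symm
  · rintro ⟨ψ, rfl⟩
    rw [h0]
    have h2 : (Ext.mk₀ (ψ ≫ ModuleCat.ofHom (C.g j))).comp ((C.ses j).se.extClass : Ext.{u} (C.Z (j+1)) (C.Z j) 1) (zero_add 1) = 0 := by
      rw [← Ext.mk₀_comp_mk₀]
      refine (Ext.comp_assoc (Ext.mk₀ ψ) _ _ (zero_add 0) (zero_add 1) (by omega)).trans ?_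
      refine (congrArg (fun t => (Ext.mk₀ ψ).comp t _) (C.ses j).se.comp_extClass).trans ?_
      exact Ext.comp_zero ..
    rw [h2, Ext.zero_comp]

theorem tau_nat {A B : ModuleCat.{u} R} (a : A ⟶ B) (j : ℕ) (φ : B ⟶ C.Z j) :
    tau C A j (a ≫ φ) = (Ext.mk₀ a).comp (tau C B j φ) (zero_add j) := by
  show (Ext.mk₀ (a ≫ φ)).comp (eta C j) (zero_add j) = _
  rw [← Ext.mk₀_comp_mk₀]
  exact Ext.comp_assoc _ _ _ (zero_add 0) (zero_add j) (by omega)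

end S8
end Pf

namespace Pf
open Paper
open CategoryTheory.Abelian
section S9
variable {R : Type u} [CommRing R]

/-- the contravariant Hom functor -/
noncomputable abbrev HF (M : ModuleCat.{u} R) : ModuleCat.{u} R ⥤ (ModuleCat.{u} R)ᵒᵖ :=
  ((linearYoneda R (ModuleCat.{u} R)).obj M).rightOp

noncomputable abbrev KC (M : ModuleCat.{u} R) {A : ModuleCat.{u} R} (P : ProjectiveResolution A) :
    ChainComplex (ModuleCat.{u} R)ᵒᵖ ℕ :=
  ((HF M).mapHomologicalComplex (ComplexShape.down ℕ)).obj P.complex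

/-- value of the old Ext functor -/
noncomputable abbrev OE (M : ModuleCat.{u} R) (n : ℕ) (A : ModuleCat.{u} R) : ModuleCat.{u} R :=
  (((HF M).leftDerived n).obj A).unop

noncomputable abbrev ZC (M : ModuleCat.{u} R) (n : ℕ) {A : ModuleCat.{u} R}
    (P : ProjectiveResolution A) : ModuleCat.{u} R :=
  ((KC M P).opcycles n).unop

noncomputable def zpi (M : ModuleCat.{u} R) (n : ℕ) {A : ModuleCat.{u} R}
    (P : ProjectiveResolution A) : ZC M n P →ₗ[R] (P.complex.X n ⟶ M) :=
  ((KC M P).pOpcycles n).unop.hom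

noncomputable def LI (M : ModuleCat.{u} R) (n : ℕ) {A : ModuleCat.{u} R}
    (P : ProjectiveResolution A) : ((HF M).leftDerived n).obj A ≅ (KC M P).homology n :=
  P.isoLeftDerivedObj (HF M) n

noncomputable def zw (M : ModuleCat.{u} R) (n : ℕ) {A : ModuleCat.{u} R}
    (P : ProjectiveResolution A) : ZC M n P →ₗ[R] OE M n A :=
  ((LI M n P).hom ≫ (KC M P).homologyι n).unop.hom

variable (M : ModuleCat.{u} R) (n : ℕ) {A B : ModuleCat.{u} R}
    (P : ProjectiveResolution A) (Q : ProjectiveResolution B)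

theorem zpi_inj : Function.Injective (zpi M n P) := by
  have : Mono ((KC M P).pOpcycles n).unop := inferInstance
  exact (ModuleCat.mono_iff_injective _).1 this

theorem zw_surj : Function.Surjective (zw M n P) := by
  have : IsIso (LI M n P).hom.unop := inferInstance
  have : Epi ((LI M n P).hom ≫ (KC M P).homologyι n).unop := by
    rw [unop_comp]; infer_instance
  exact (ModuleCat.epi_iff_surjective _).1 this

theorem zpi_cocycle (z : ZC M n P) : P.complex.d (n+1) n ≫ zpi M n P z = 0 := by
  have h := (KC M P).d_pOpcycles (n+1) n
  have h2 : ((KC M P).pOpcycles n).unop ≫ ((KC M P).d (n+1) n).unop = 0 := by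
    rw [← unop_comp, h]; rfl
  exact congrArg (fun t => t.hom z) h2

theorem exists_zpi (f : P.complex.X n ⟶ M) (hf : P.complex.d (n+1) n ≫ f = 0) :
    ∃ z, zpi M n P z = f := by
  have h := ShortComplex.exact_of_g_is_cokernel (ShortComplex.mk _ _ ((KC M P).d_pOpcycles (n+1) n))
    ((KC M P).opcyclesIsCokernel (n+1) n (by simp))
  have h2 := (ShortComplex.moduleCat_exact_iff _).1 h.unop
  exact h2 f hf

theorem zw_zero (z : ZC M n P) (j : ℕ) (hj : (ComplexShape.down ℕ).next n = j) :
    zw M n P z = 0 ↔ ∃ g : P.complex.X j ⟶ M, P.complex.d n j ≫ g = zpi M n P z := by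
  have h := ShortComplex.exact_of_f_is_kernel (ShortComplex.mk _ _ ((KC M P).homologyι_comp_fromOpcycles n j))
    ((KC M P).homologyIsKernel n j hj)
  have h2 := (ShortComplex.moduleCat_exact_iff _).1 h.unop
  have hd : ((KC M P).fromOpcycles n j).unop ≫ ((KC M P).pOpcycles n).unop = ((KC M P).d n j).unop := by
    rw [← unop_comp, (KC M P).p_fromOpcycles]
  have hd' : ∀ g : P.complex.X j ⟶ M, zpi M n P (((KC M P).fromOpcycles n j).unop.hom g) = P.complex.d n j ≫ g :=
    fun g => congrArg (fun t => t.hom g) hd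
  have hz : zw M n P z = 0 ↔ ((KC M P).homologyι n).unop.hom z = 0 := by
    have hi : Function.Injective (LI M n P).hom.unop.hom :=
      (ModuleCat.mono_iff_injective _).1 inferInstance
    constructor
    · intro h
      exact hi (h.trans (map_zero _).symm)
    · intro h
      exact (congrArg (LI M n P).hom.unop.hom h).trans (map_zero _)
  rw [hz]
  constructor
  · intro h
    obtain ⟨g, hg⟩ := h2 z h
    exact ⟨g, (hd' g).symm.trans (congrArg _ hg)⟩
  · rintro ⟨g, hg⟩
    have : ((KC M P).fromOpcycles n j).unop.hom g = z := zpi_inj M n P ((hd' g).trans hg)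
    rw [← this]
    have h3 : ((KC M P).fromOpcycles n j).unop ≫ ((KC M P).homologyι n).unop = 0 := by
      rw [← unop_comp, (KC M P).homologyι_comp_fromOpcycles]; rfl
    exact congrArg (fun t => t.hom g) h3

/-- functoriality of the cocycle modules -/
theorem z_nat (a : A ⟶ B) (φ : ProjectiveResolution.Hom P Q a) (z : ZC M n Q) :
    ∃ z' : ZC M n P, zpi M n P z' = φ.hom.f n ≫ zpi M n Q z ∧
      (((HF M).leftDerived n).map a).unop.hom (zw M n Q z) = zw M n P z' := by
  let ψ : KC M P ⟶ KC M Q := ((HF M).mapHomologicalComplex (ComplexShape.down ℕ)).map φ.hom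
  refine ⟨(HomologicalComplex.opcyclesMap ψ n).unop.hom z, ?_, ?_⟩
  · have h := HomologicalComplex.p_opcyclesMap ψ n
    have h2 : (HomologicalComplex.opcyclesMap ψ n).unop ≫ ((KC M P).pOpcycles n).unop =
      ((KC M Q).pOpcycles n).unop ≫ (ψ.f n).unop := by
      rw [← unop_comp, h]; rfl
    exact congrArg (fun t => t.hom z) h2
  · have h : ((HF M).leftDerived n).map a ≫ (LI M n Q).hom = (LI M n P).hom ≫ HomologicalComplex.homologyMap ψ n :=
      ProjectiveResolution.isoLeftDerivedObj_hom_naturality a P Q φ.hom φ.hom_f_zero_comp_π_f_zero (HF M) n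
    have h1 := HomologicalComplex.homologyι_naturality ψ n
    have h2 : ((HF M).leftDerived n).map a ≫ ((LI M n Q).hom ≫ (KC M Q).homologyι n) =
      ((LI M n P).hom ≫ (KC M P).homologyι n) ≫ HomologicalComplex.opcyclesMap ψ n := by
      rw [Category.assoc, ← h1, ← Category.assoc, h, Category.assoc]
    have h3 := congrArg Quiver.Hom.unop h2
    exact congrArg (fun t => t.hom z) h3

end S9
end Pf

namespace Pf
open Paper
open CategoryTheory.Abelian
section S10
variable {R : Type u} [CommRing R]
variable (M : ModuleCat.{u} R) (n : ℕ) {A B : ModuleCat.{u} R}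
    (P : ProjectiveResolution A) (Q : ProjectiveResolution B)

theorem extMk_zero_zero (f : P.complex.X 0 ⟶ M) (hf : P.complex.d 1 0 ≫ f = 0)
    (h : (P.extMk f 1 rfl hf : Ext.{u} A M 0) = 0) : f = 0 := by
  simp only [← P.extEquivCohomologyClass.apply_eq_iff_eq,
    ProjectiveResolution.extEquivCohomologyClass_extMk, ProjectiveResolution.extEquivCohomologyClass_zero,
    CochainComplex.HomComplex.CohomologyClass.mk_eq_zero_iff] at h
  rw [CochainComplex.HomComplex.Cocycle.toSingleMk_mem_coboundaries_iff _ _ _ _ _ 1 (by simp)] at h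
  obtain ⟨g, hg⟩ := h
  have hz : Limits.IsZero (P.cochainComplex.X 1) := CochainComplex.isZero_of_isStrictlyLE _ 0 _
  have h0 : g = 0 := hz.eq_of_src _ _
  rw [h0, Limits.comp_zero] at hg
  have := congrArg (fun t => (P.cochainComplexXIso (-(0:ℕ)) 0 rfl).inv ≫ t) hg
  simpa using this.symm

noncomputable def em : ZC M n P →ₗ[R] Ext.{u} A M n where
  toFun z := P.extMk (zpi M n P z) (n+1) rfl (zpi_cocycle M n P z)
  map_add' z z' := by
    rw [ProjectiveResolution.add_extMk]
    congr 1
    exact map_add _ _ _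
  map_smul' r z := by
    rw [RingHom.id_apply, Ext.smul_eq_comp_mk₀, ProjectiveResolution.extMk_comp_mk₀]
    congr 1
    rw [map_smul]
    simp

theorem em_surj : Function.Surjective (em M n P) := by
  intro e
  obtain ⟨f, hf, rfl⟩ := P.extMk_surjective e (n+1) rfl
  obtain ⟨z, rfl⟩ := exists_zpi M n P f hf
  exact ⟨z, rfl⟩

theorem em_ker : LinearMap.ker (zw M n P) = LinearMap.ker (em M n P) := by
  ext z
  rw [LinearMap.mem_ker, LinearMap.mem_ker]
  have he : em M n P z = P.extMk (zpi M n P z) (n+1) rfl (zpi_cocycle M n P z) := rfl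
  rw [he]
  cases n with
  | zero =>
    rw [zw_zero M 0 P z 0 (by simp)]
    constructor
    · rintro ⟨g, hg⟩
      have : zpi M 0 P z = 0 := by rw [← hg]; simp
      simp only [this]
      exact ProjectiveResolution.extMk_zero ..
    · intro h
      refine ⟨0, ?_⟩
      rw [extMk_zero_zero M P _ _ h]; simp
  | succ p =>
    rw [zw_zero M (p+1) P z p (by simp), ProjectiveResolution.extMk_eq_zero_iff _ _ _ _ _ p rfl]

/-- comparison of old and new Ext -/
noncomputable def psi : OE M n A ≃ₗ[R] Ext.{u} A M n :=
  ((zw M n P).quotKerEquivOfSurjective (zw_surj M n P)).symm ≪≫ₗ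
    Submodule.quotEquivOfEq _ _ (em_ker M n P) ≪≫ₗ
    (em M n P).quotKerEquivOfSurjective (em_surj M n P)

theorem psi_zw (z : ZC M n P) : psi M n P (zw M n P z) = em M n P z := by
  have : ((zw M n P).quotKerEquivOfSurjective (zw_surj M n P)).symm (zw M n P z) = Submodule.Quotient.mk z := by
    rw [LinearEquiv.symm_apply_eq]; rfl
  show (em M n P).quotKerEquivOfSurjective (em_surj M n P) (Submodule.quotEquivOfEq _ _ (em_ker M n P)
    (((zw M n P).quotKerEquivOfSurjective (zw_surj M n P)).symm (zw M n P z))) = _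
  rw [this]; rfl

theorem psi_nat (a : A ⟶ B) (x : OE M n B) :
    psi M n P ((((HF M).leftDerived n).map a).unop.hom x) =
      (Ext.mk₀ a).comp (psi M n Q x) (zero_add n) := by
  let φ : ProjectiveResolution.Hom P Q a :=
    ⟨ProjectiveResolution.lift a P Q, by
      have := congrArg (fun t => t.f 0) (ProjectiveResolution.lift_commutes a P Q)
      exact this⟩
  obtain ⟨z, rfl⟩ := zw_surj M n Q x
  obtain ⟨z', h1, h2⟩ := z_nat M n P Q a φ z
  rw [h2, psi_zw, psi_zw]
  have e1 : em M n P z' = P.extMk (zpi M n P z') (n+1) rfl (zpi_cocycle M n P z') := rfl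
  have e2 : em M n Q z = Q.extMk (zpi M n Q z) (n+1) rfl (zpi_cocycle M n Q z) := rfl
  rw [e1, e2, ProjectiveResolution.mk₀_comp_extMk _ _ _ _ φ]
  simp only [h1]

/-- map from homomorphisms into a cosyzygy to old Ext -/
noncomputable def sig (C : Chain R) (A : ModuleCat.{u} R) (j : ℕ) : (A ⟶ C.Z j) →ₗ[R] OE (C.Z 0) j A :=
  (psi (C.Z 0) j (projectiveResolution A)).symm.toLinearMap ∘ₗ tau C A j

theorem sig_surj (C : Chain R) (A : ModuleCat.{u} R) (j : ℕ) : Function.Surjective (sig C A j) :=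
  (psi (C.Z 0) j (projectiveResolution A)).symm.surjective.comp (tau_surj C A j)

theorem sig_zero (C : Chain R) (A : ModuleCat.{u} R) (j : ℕ) (φ : A ⟶ C.Z j) :
    sig C A j φ = 0 ↔ tau C A j φ = 0 :=
  (psi (C.Z 0) j (projectiveResolution A)).symm.map_eq_zero_iff

theorem sig_nat (C : Chain R) (a : A ⟶ B) (j : ℕ) (φ : B ⟶ C.Z j) :
    sig C A j (a ≫ φ) = (((HF (C.Z 0)).leftDerived j).map a).unop.hom (sig C B j φ) := by
  show (psi (C.Z 0) j (projectiveResolution A)).symm (tau C A j (a ≫ φ)) = _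
  rw [LinearEquiv.symm_apply_eq, psi_nat _ _ _ (projectiveResolution B), tau_nat]
  congr 1
  exact ((psi (C.Z 0) j (projectiveResolution B)).apply_symm_apply _).symm

end S10
end Pf

namespace Pf
open Paper
open CategoryTheory.Abelian
section S11
variable {R : Type u} [CommRing R]

/-- the cyclic module -/
abbrev Cy (J : Ideal R) (t : ℕ) : ModuleCat.{u} R := ModuleCat.of R (R ⧸ J ^ t)

/-- transition map -/
noncomputable def ctr (J : Ideal R) {s t : ℕ} (h : s ≤ t) : Cy J t ⟶ Cy J s :=
  ModuleCat.ofHom (Submodule.mapQ (J ^ t) (J ^ s) LinearMap.id (Ideal.pow_le_pow_right h))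

noncomputable abbrev otr (J : Ideal R) (j : ℕ) (M : ModuleCat.{u} R) {s t : ℕ} (h : s ≤ t) :
    OE M j (Cy J s) →ₗ[R] OE M j (Cy J t) :=
  (((HF M).leftDerived j).map (ctr J h)).unop.hom

theorem colim_zero (G : (ℕᵒᵖ)ᵒᵖ ⥤ ModuleCat.{u} R) (c : Limits.Cocone G) (hc : Limits.IsColimit c)
    (s : (ℕᵒᵖ)ᵒᵖ) (y : G.obj s) (hy : (c.ι.app s).hom y = 0) : ∃ (t : _) (f : s ⟶ t), (G.map f).hom y = 0 := by
  have hp : Limits.PreservesFilteredColimitsOfSize.{0,0} (forget (ModuleCat.{u} R)) :=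
    Limits.preservesFilteredColimitsOfSize_shrink.{0,u,0,u} (forget (ModuleCat.{u} R))
  obtain ⟨t, f, g, h⟩ := Limits.Concrete.isColimit_exists_of_rep_eq G hc y (0 : G.obj s)
      (hy.trans (map_zero (c.ι.app s).hom).symm)
  exact ⟨t, f, h.trans (map_zero (G.map g).hom)⟩

theorem colim_rep (G : (ℕᵒᵖ)ᵒᵖ ⥤ ModuleCat.{u} R) (c : Limits.Cocone G) (hc : Limits.IsColimit c)
    (x : c.pt) : ∃ (t : _) (y : G.obj t), (c.ι.app t).hom y = x := by
  have hp : Limits.PreservesFilteredColimitsOfSize.{0,0} (forget (ModuleCat.{u} R)) :=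
    Limits.preservesFilteredColimitsOfSize_shrink.{0,u,0,u} (forget (ModuleCat.{u} R))
  exact Limits.Concrete.isColimit_exists_rep G hc x

theorem exists_lam (J : Ideal R) (j : ℕ) (M : ModuleCat.{u} R) :
    ∃ lam : ∀ t : ℕ, OE M j (Cy J t) →ₗ[R] (localCohomology J j).obj M,
      (∀ x, ∃ t y, lam t y = x) ∧
      (∀ (s t : ℕ) (h : s ≤ t) y, lam t (otr J j M h y) = lam s y) ∧
      (∀ (s : ℕ) y, lam s y = 0 → ∃ (t : ℕ) (h : s ≤ t), otr J j M h y = 0) := by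
  have hD := localCohomology.hasColimitDiagram.{u, 0} (localCohomology.idealPowersDiagram J) j
  let D := localCohomology.diagram (localCohomology.idealPowersDiagram J) j
  let c := Limits.colimit.cocone D
  let E := (evaluation (ModuleCat.{u} R) (ModuleCat.{u} R)).obj M
  have hc : Limits.IsColimit (E.mapCocone c) := Limits.isColimitOfPreserves E (Limits.colimit.isColimit D)
  let c' := E.mapCocone c
  refine ⟨fun t => (c'.ι.app (Opposite.op (Opposite.op t))).hom, ?_, ?_, ?_⟩
  · intro x
    obtain ⟨t, y, hy⟩ := colim_rep _ _ hc x
    exact ⟨t.unop.unop, y, hy⟩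
  · intro s t h y
    have := c'.w (homOfLE h).op.op
    exact congrArg (fun q => q.hom y) this
  · intro s y hy
    obtain ⟨t, f, h⟩ := colim_zero _ _ hc (Opposite.op (Opposite.op s)) y hy
    exact ⟨t.unop.unop, leOfHom f.unop.unop, h⟩

end S11
end Pf

namespace Pf
open Paper
open CategoryTheory.Abelian
section S12
variable {R : Type u} [CommRing R]

/-- the map from a cyclic module attached to an element -/
noncomputable def phi (J : Ideal R) (t : ℕ) {X : ModuleCat.{u} R} (z : X) (h : ∀ r ∈ J ^ t, r • z = 0) :
    Cy J t ⟶ X :=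
  ModuleCat.ofHom (Submodule.liftQ (J ^ t) (LinearMap.toSpanSingleton R X z) (fun r hr => h r hr))

theorem phi_mk (J : Ideal R) (t : ℕ) {X : ModuleCat.{u} R} (z : X) (h : ∀ r ∈ J ^ t, r • z = 0) (r : R) :
    (phi J t z h).hom (Submodule.Quotient.mk r) = r • z := rfl

theorem cy_ext (J : Ideal R) (t : ℕ) {X : ModuleCat.{u} R} (f g : Cy J t ⟶ X)
    (h : f.hom (Submodule.Quotient.mk (1 : R)) = g.hom (Submodule.Quotient.mk (1 : R))) : f = g := by
  apply ModuleCat.hom_ext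
  apply LinearMap.ext
  intro x
  obtain ⟨r, rfl⟩ := Submodule.Quotient.mk_surjective _ x
  have : (Submodule.Quotient.mk r : R ⧸ J ^ t) = r • Submodule.Quotient.mk (1 : R) := by
    rw [← Submodule.Quotient.mk_smul]; simp
  rw [this, map_smul, map_smul, h]

theorem ctr_phi (J : Ideal R) {s t : ℕ} (hst : s ≤ t) {X : ModuleCat.{u} R} (z : X)
    (h : ∀ r ∈ J ^ s, r • z = 0) (h' : ∀ r ∈ J ^ t, r • z = 0) :
    ctr J hst ≫ phi J s z h = phi J t z h' := by
  apply cy_ext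
  rfl

theorem hom_one (J : Ideal R) (t : ℕ) {X : ModuleCat.{u} R} (f : Cy J t ⟶ X) :
    ∀ r ∈ J ^ t, r • f.hom (Submodule.Quotient.mk (1 : R)) = 0 := by
  intro r hr
  rw [← map_smul, ← Submodule.Quotient.mk_smul, smul_eq_mul, mul_one,
    (Submodule.Quotient.mk_eq_zero _).2 hr, map_zero]

variable [IsNoetherianRing R]

theorem lc_equiv (C : Chain R) (L : List R) (j : ℕ) :
    Nonempty ((localCohomology (Ideal.span {x | x ∈ L}) j).obj (C.Z 0) ≃ₗ[R] Hc C L j) := by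
  obtain ⟨lam, hs, hn, hk⟩ := exists_lam (Ideal.span {x | x ∈ L}) j (C.Z 0)
  generalize hJ : Ideal.span {x | x ∈ L} = J at *
  have hmem : ∀ {X : ModuleCat.{u} R} (z : X), z ∈ tors L X ↔ ∃ t, ∀ r ∈ J ^ t, r • z = 0 := by
    intro X z
    rw [mem_tors_iff, hJ]
  have mono : ∀ {X : ModuleCat.{u} R} {z : X} {s t : ℕ}, s ≤ t → (∀ r ∈ J ^ s, r • z = 0) →
      ∀ r ∈ J ^ t, r • z = 0 := fun h hz r hr => hz r (Ideal.pow_le_pow_right h hr)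
  have indep1 : ∀ (z : C.Z j) (s t : ℕ) (hst : s ≤ t) (h : ∀ r ∈ J ^ s, r • z = 0)
      (h' : ∀ r ∈ J ^ t, r • z = 0),
      lam s (sig C _ j (phi J s z h)) = lam t (sig C _ j (phi J t z h')) := by
    intro z s t hst h h'
    rw [← hn s t hst, ← ctr_phi J hst z h h', sig_nat]
  have indep : ∀ (z : C.Z j) (s t : ℕ) (h : ∀ r ∈ J ^ s, r • z = 0)
      (h' : ∀ r ∈ J ^ t, r • z = 0),
      lam s (sig C _ j (phi J s z h)) = lam t (sig C _ j (phi J t z h')) := by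
    intro z s t h h'
    rcases le_total s t with hst | hst
    · exact indep1 z s t hst h h'
    · exact (indep1 z t s hst h' h).symm
  choose T hT using fun z : tors L (C.Z j) => (hmem z.1).1 z.2
  let Φ : tors L (C.Z j) →ₗ[R] (localCohomology J j).obj (C.Z 0) :=
    { toFun := fun z => lam (T z) (sig C _ j (phi J (T z) z.1 (hT z)))
      map_add' := by
        intro z w
        have h1 := mono (le_max_left (T z) (T w)) (hT z)
        have h2 := mono (le_max_right (T z) (T w)) (hT w)
        have h3 : ∀ r ∈ J ^ (max (T z) (T w)), r • (z + w).1 = 0 := by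
          intro r hr
          show r • (z.1 + w.1) = 0
          rw [smul_add, h1 r hr, h2 r hr, add_zero]
        rw [indep z.1 _ _ (hT z) h1, indep w.1 _ _ (hT w) h2, indep (z + w).1 _ _ (hT _) h3,
          ← map_add, ← map_add]
        congr 2
        apply cy_ext
        show (1 : R) • (z.1 + w.1) = (1 : R) • z.1 + (1 : R) • w.1
        rw [smul_add]
      map_smul' := by
        intro a z
        have h3 : ∀ r ∈ J ^ (T z), r • (a • z).1 = 0 := by
          intro r hr
          show r • a • z.1 = 0
          rw [smul_comm, hT z r hr, smul_zero]
        rw [indep (a • z).1 _ _ (hT _) h3, RingHom.id_apply, ← map_smul, ← map_smul]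
        congr 2
        apply cy_ext
        show (1 : R) • (a • z.1) = a • ((1 : R) • z.1)
        rw [one_smul, one_smul] }
  have hΦ : ∀ z t (h : ∀ r ∈ J ^ t, r • z.1 = 0), Φ z = lam t (sig C _ j (phi J t z.1 h)) :=
    fun z t h => indep z.1 _ _ (hT z) h
  have surj : Function.Surjective Φ := by
    intro x
    obtain ⟨t, y, rfl⟩ := hs x
    obtain ⟨φ, rfl⟩ := sig_surj C _ j y
    have h1 := hom_one J t φ
    refine ⟨⟨φ.hom (Submodule.Quotient.mk (1 : R)), (hmem _).2 ⟨t, h1⟩⟩, ?_⟩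
    rw [hΦ _ t h1]
    congr 2
    apply cy_ext
    rw [phi_mk, one_smul]
  have ker : LinearMap.ker Φ = (Bs C L j).comap (tors L (C.Z j)).subtype := by
    have key : ∀ z : tors L (C.Z j), Φ z = 0 ↔ ∃ t, ∃ h : ∀ r ∈ J ^ t, r • z.1 = 0,
        tau C _ j (phi J t z.1 h) = 0 := by
      intro z
      constructor
      · intro hz
        obtain ⟨t, hst, ht⟩ := hk _ _ hz
        refine ⟨t, mono hst (hT z), ?_⟩
        rw [← sig_zero, ← ctr_phi J hst z.1 (hT z), sig_nat]
        exact ht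
      · rintro ⟨t, h, ht⟩
        rw [hΦ z t h, (sig_zero C _ j _).2 ht, map_zero]
    ext z
    rw [LinearMap.mem_ker, key, Submodule.mem_comap]
    show _ ↔ z.1 ∈ Bs C L j
    cases j with
    | zero =>
      show _ ↔ z.1 ∈ (⊥ : Submodule R (C.Z 0))
      rw [Submodule.mem_bot]
      constructor
      · rintro ⟨t, h, ht⟩
        rw [tau_zero] at ht
        have := phi_mk J t z.1 h 1
        rw [ht, one_smul] at this
        exact this.symm
      · intro hz
        have h : ∀ r ∈ J ^ 0, r • z.1 = 0 := by intro r _; rw [hz, smul_zero]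
        refine ⟨0, h, (tau_zero ..).2 ?_⟩
        apply cy_ext
        rw [phi_mk, hz, smul_zero]; rfl
    | succ j =>
      show _ ↔ z.1 ∈ (tors L (C.I j)).map (C.g j)
      rw [Submodule.mem_map]
      constructor
      · rintro ⟨t, h, ht⟩
        rw [tau_succ] at ht
        obtain ⟨ψ, hψ⟩ := ht
        refine ⟨ψ.hom (Submodule.Quotient.mk (1 : R)), (hmem _).2 ⟨t, hom_one J t ψ⟩, ?_⟩
        have := phi_mk J t z.1 h 1
        rw [← hψ, one_smul] at this
        exact this
      · rintro ⟨y, hy, hyz⟩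
        obtain ⟨t, ht⟩ := (hmem y).1 hy
        have h : ∀ r ∈ J ^ t, r • z.1 = 0 := by
          intro r hr
          rw [← hyz, ← map_smul, ht r hr, map_zero]
        refine ⟨t, h, (tau_succ ..).2 ⟨phi J t y ht, ?_⟩⟩
        apply cy_ext
        show C.g j ((1 : R) • y) = (1 : R) • z.1
        rw [one_smul, one_smul, hyz]
  exact ⟨(Submodule.quotEquivOfEq _ _ ker.symm ≪≫ₗ Φ.quotKerEquivOfSurjective surj).symm⟩

theorem hB_of_relCM (C : Chain R) (L : List R) (j : ℕ)
    (h : Subsingleton ((localCohomology (Ideal.span {x | x ∈ L}) j).obj (C.Z 0))) :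
    Bs C L j = tors L (C.Z j) := by
  obtain ⟨e⟩ := lc_equiv C L j
  have : Subsingleton (Hc C L j) := e.symm.toEquiv.subsingleton
  have h2 := Submodule.Quotient.subsingleton_iff.1 this
  refine le_antisymm (Bs_le C L j) fun z hz => ?_
  have : (⟨z, hz⟩ : tors L (C.Z j)) ∈ (Bs C L j).comap (tors L (C.Z j)).subtype := by
    rw [h2]; trivial
  exact this

end S12
end Pf

namespace Pf
open Paper
open CategoryTheory.Abelian
section S13
variable {R : Type u} [CommRing R] [IsNoetherianRing R] [IsLocalRing R]

theorem final (L : List R) (hL : ∀ x ∈ L, x ∈ maximalIdeal R) (C : Chain R) (n : ℕ)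
    [Module.Finite R (C.Z 0)]
    (hrel : ∀ i, i ≠ n → Subsingleton ((localCohomology (Ideal.span {x | x ∈ L}) i).obj (C.Z 0)))
    (h₁ : GinjDim R ((localCohomology (Ideal.span {x | x ∈ L}) n).obj (C.Z 0)) ≠ ⊤)
    (h₂ : GflatDim R ((localCohomology (Ideal.span {x | x ∈ L}) n).obj (C.Z 0)) ≠ ⊤) :
    projDim R (C.Z 0) ≠ ⊤ ↔ injDim R (C.Z 0) ≠ ⊤ := by
  have hB : ∀ j, j ≠ n → Bs C L j = tors L (C.Z j) := fun j hj => hB_of_relCM C L j (hrel j hj)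
  obtain ⟨e⟩ := lc_equiv C L n
  generalize (localCohomology (Ideal.span {x | x ∈ L}) n).obj (C.Z 0) = H at *
  have hk : ∀ x ∈ L, ∀ v : R ⧸ maximalIdeal R, x • v = 0 := by
    intro x hx v
    obtain ⟨r, rfl⟩ := Ideal.Quotient.mk_surjective v
    rw [← Ideal.Quotient.mk_eq_mk, ← Submodule.Quotient.mk_smul]
    exact (Submodule.Quotient.mk_eq_zero _).2 (Ideal.mul_mem_right _ _ (hL x hx))
  have hk' : ∀ x ∈ L, ∀ v : CharacterModule (R ⧸ maximalIdeal R), x • v = 0 := by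
    intro x hx v
    ext y
    rw [CharacterModule.smul_apply, hk x hx, map_zero]; rfl
  constructor
  · intro h
    obtain ⟨s, hs⟩ := (projDim_iff (C.Z 0)).1 h
    obtain ⟨b, hb⟩ := GinjDim_lemma H h₁ (s + n + 1) (fun K hK =>
      ev_congr e (main_d C L n hB s K hK (fun i hi => hs K i hi) _ (by omega)))
    exact bass (C.Z 0) (n + b) (main_c C L n hB b (R ⧸ maximalIdeal R) hk
      (fun i hi => ev_congr' e.symm (hb _ i hi)))
  · intro h
    obtain ⟨s, hs⟩ := (injDim_iff (C.Z 0)).1 h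
    obtain ⟨b, hb⟩ := main_f C L n hB s hs
    obtain ⟨b', hb'⟩ := GflatDim_lemma H h₂ b (fun A _ _ i hi => ev_congr' e (hb A i hi))
    exact pd_of_char (C.Z 0) b' (main_e C L n hB b' (CharacterModule (R ⧸ maximalIdeal R)) hk'
      (fun i hi => ev_congr e.symm (hb' _ i hi)))

theorem final' (𝔞 : Ideal R) (h𝔞 : 𝔞 ≠ ⊤) (N : ModuleCat.{u} R) [Module.Finite R N] (n : ℕ)
    (hrel : ∀ i, i ≠ n → Subsingleton ((localCohomology 𝔞 i).obj N))
    (h₁ : GinjDim R ((localCohomology 𝔞 n).obj N) ≠ ⊤)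
    (h₂ : GflatDim R ((localCohomology 𝔞 n).obj N) ≠ ⊤) :
    projDim R N ≠ ⊤ ↔ injDim R N ≠ ⊤ := by
  obtain ⟨S, hS⟩ := (isNoetherianRing_iff_ideal_fg R).1 inferInstance 𝔞
  have hS' : Ideal.span {x | x ∈ S.toList} = 𝔞 := by
    rw [← hS]; congr 1; ext x; simp
  obtain ⟨C, rfl⟩ := exists_chain N
  subst hS'
  exact final S.toList (fun x hx => le_maximalIdeal h𝔞 (Ideal.subset_span hx)) C n hrel h₁ h₂

end S13
end Pf

open Paper IsLocalRing

/-- **Proposition 3.10.** Let `M` be a finitely generated module which is relative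
Cohen-Macaulay with respect to a proper ideal `𝔞` with `ht_M 𝔞 = n`. If both
`Gid_R H^n_𝔞(M)` and `Gfd_R H^n_𝔞(M)` are finite, then `pd_R M` is finite iff
`id_R M` is finite. -/
theorem projDim_ne_top_iff_injDim_ne_top
    (R : Type u) [CommRing R] [IsNoetherianRing R] [IsLocalRing R]
    (𝔞 : Ideal R) (h𝔞 : 𝔞 ≠ ⊤)
    (M : Type u) [AddCommGroup M] [Module R M] [Module.Finite R M]
    (n : ℕ) (hrel : IsRelCM R 𝔞 n M)
    (h₁ : GinjDim R (lcoh R 𝔞 n M) ≠ ⊤)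
    (h₂ : GflatDim R (lcoh R 𝔞 n M) ≠ ⊤) :
    projDim R M ≠ ⊤ ↔ injDim R M ≠ ⊤ := by
  exact Pf.final' 𝔞 h𝔞 (ModuleCat.of R M) n hrel.1 h₁ h₂
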